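/- arXiv:1601.02972 — 8 statements merged into one kernel-verified Lean document; each statement's English description precedes it below -/
import Mathlib

section
/- For all real numbers r > 0 and s > 0, one has θ₃(rs) · θ₃(r/s) ≥ θ₃(r)², with equality if and only if s = 1. -/
noncomputable def theta3 (s : ℝ) : ℝ := ∑' k : ℤ, Real.exp (-Real.pi * (k : ℝ) ^ 2 * s)

noncomputable def Th (j : ℕ) (x : ℝ) : ℝ :=
  ∑' k : ℤ, (Real.pi * (k : ℝ) ^ 2) ^ j * Real.exp (-(Real.pi * (k : ℝ) ^ 2) * x)

lemma Th_summable (j : ℕ) {x : ℝ} (hx : 0 < x) :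
    Summable (fun k : ℤ => (Real.pi * (k : ℝ) ^ 2) ^ j * Real.exp (-(Real.pi * (k : ℝ) ^ 2) * x)) := by
  have h := (summable_pow_mul_jacobiTheta₂_term_bound 0 hx (2 * j)).mul_left (Real.pi ^ j)
  refine h.congr fun k => ?_
  have h1 : (((|k| : ℤ) : ℝ)) ^ (2 * j) = ((k : ℝ) ^ 2) ^ j := by
    rw [pow_mul]; push_cast; rw [sq_abs]
  rw [h1, mul_pow, ← mul_assoc]
  congr 2
  ring

lemma Th_hasDerivAt (j : ℕ) {x : ℝ} (hx : 0 < x) : HasDerivAt (Th j) (-Th (j + 1) x) x := by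
  have hx2 : 0 < x / 2 := by positivity
  have h := hasDerivAt_tsum_of_isPreconnected (𝕜 := ℝ) (t := Set.Ioi (x / 2)) (y₀ := x) (y := x)
    (g := fun (k : ℤ) y => (Real.pi * (k : ℝ) ^ 2) ^ j * Real.exp (-(Real.pi * (k : ℝ) ^ 2) * y))
    (g' := fun (k : ℤ) y => -((Real.pi * (k : ℝ) ^ 2) ^ (j + 1) *
      Real.exp (-(Real.pi * (k : ℝ) ^ 2) * y)))
    (Th_summable (j + 1) hx2) isOpen_Ioi isPreconnected_Ioi ?_ ?_
    (by simp only [Set.mem_Ioi]; linarith) (Th_summable j hx) (by simp only [Set.mem_Ioi]; linarith)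
  · rw [tsum_neg] at h
    exact h
  · intro k y _
    have h1 : HasDerivAt (fun y : ℝ => -(Real.pi * (k : ℝ) ^ 2) * y) (-(Real.pi * (k : ℝ) ^ 2)) y := by
      simpa using (hasDerivAt_id y).const_mul (-(Real.pi * (k : ℝ) ^ 2))
    exact ((h1.exp).const_mul ((Real.pi * (k : ℝ) ^ 2) ^ j)).congr_deriv (by ring)
  · intro k y hy
    have hp : 0 ≤ Real.pi * (k : ℝ) ^ 2 := by positivity
    rw [norm_neg, Real.norm_of_nonneg (by positivity)]
    gcongr ?_ * Real.exp ?_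
    have : x / 2 ≤ y := le_of_lt hy
    nlinarith

lemma Th_zero_ge {x : ℝ} (hx : 0 < x) : 1 ≤ Th 0 x := by
  have := (Th_summable 0 hx).le_tsum 0 (fun k _ => by positivity)
  simpa [Th] using this

lemma Th_one_pos {x : ℝ} (hx : 0 < x) : 0 < Th 1 x := by
  have := (Th_summable 1 hx).le_tsum 1 (fun k _ => by positivity)
  refine lt_of_lt_of_le ?_ this
  positivity

lemma Th_two_ge {x : ℝ} (hx : 0 < x) : Real.pi * Th 1 x ≤ Th 2 x := by
  unfold Th
  rw [← tsum_mul_left]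
  refine ((Th_summable 1 hx).mul_left _).tsum_le_tsum (fun k => ?_) (Th_summable 2 hx)
  rw [← mul_assoc]
  gcongr ?_ * _
  rcases eq_or_ne k 0 with rfl | hk
  · simp
  have h1 : (1 : ℝ) ≤ (k : ℝ) ^ 2 := by
    have : 1 ≤ k ^ 2 := by have := sq_nonneg k; have : k ^ 2 ≠ 0 := by positivity
                           omega
    exact_mod_cast this
  have : Real.pi * (Real.pi * (k : ℝ) ^ 2) * 1 ≤ Real.pi * (Real.pi * (k : ℝ) ^ 2) * (k : ℝ) ^ 2 := by
    gcongr
  nlinarith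

lemma Th_one_lt {x : ℝ} (hx : 1 ≤ x) : Th 1 x < 2 := by
  have hz := hasSum_zeta_four
  have hz' : HasSum (fun k : ℤ => 6 / Real.pi ^ 2 * (1 / (k : ℝ) ^ 4))
      (6 / Real.pi ^ 2 * (Real.pi ^ 4 / 90 + Real.pi ^ 4 / 90)) := by
    refine HasSum.mul_left _ ?_
    have h2 := HasSum.of_nat_of_neg (f := fun k : ℤ => 1 / (k : ℝ) ^ 4) (by simpa using hz)
      (by simpa [Even.neg_pow (by decide : Even 4)] using hz)
    simpa using h2
  have hle : Th 1 x ≤ 6 / Real.pi ^ 2 * (Real.pi ^ 4 / 90 + Real.pi ^ 4 / 90) := by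
    refine hasSum_le (fun k => ?_) (Th_summable 1 (by linarith : 0 < x)).hasSum hz'
    rcases eq_or_ne k 0 with rfl | hk
    · simp
    have hk' : (k : ℝ) ≠ 0 := by exact_mod_cast hk
    have hpi := Real.pi_pos
    set y := Real.pi * (k : ℝ) ^ 2 with hy
    have hy0 : 0 < y := by positivity
    have h1 : y ^ 3 / 6 ≤ Real.exp y := by
      have := Real.pow_div_factorial_le_exp y hy0.le 3
      simpa [Nat.factorial] using this
    have h2 : Real.exp (-y * x) ≤ Real.exp (-y) := Real.exp_le_exp.2 (by nlinarith)
    have h3 : Real.exp (-y) ≤ 6 / y ^ 3 := by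
      rw [Real.exp_neg, ← inv_div]
      exact inv_anti₀ (by positivity) h1
    calc y ^ 1 * Real.exp (-y * x) ≤ y ^ 1 * (6 / y ^ 3) := by gcongr; exact h2.trans h3
      _ = 6 / Real.pi ^ 2 * (1 / (k : ℝ) ^ 4) := by
        rw [hy]; field_simp
  have hpi := Real.pi_pos
  have e : 6 / Real.pi ^ 2 * (Real.pi ^ 4 / 90 + Real.pi ^ 4 / 90) = 2 / 15 * Real.pi ^ 2 := by
    field_simp; ring
  rw [e] at hle
  nlinarith [Real.pi_lt_d2]

lemma key {x : ℝ} (hx : 1 ≤ x) : x * Th 1 x ^ 2 < (x * Th 2 x - Th 1 x) * Th 0 x := by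
  have h0 : 0 < x := by linarith
  have a := Th_zero_ge h0
  have b := Th_one_pos h0
  have c := Th_two_ge h0
  have d := Th_one_lt hx
  have p := Real.pi_gt_three
  have e : x * Th 1 x < Real.pi * x - 1 := by nlinarith
  have e1 : x * Th 1 x ^ 2 < (Real.pi * x - 1) * Th 1 x := by nlinarith
  have e2 : (Real.pi * x - 1) * Th 1 x ≤ x * Th 2 x - Th 1 x := by nlinarith
  have e3 : 0 < x * Th 2 x - Th 1 x := by nlinarith [mul_pos h0 (pow_pos b 2)]
  nlinarith

lemma theta3_eq (x : ℝ) : theta3 x = Th 0 x := by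
  simp [theta3, Th]

lemma Th_inv {x : ℝ} (hx : 0 < x) : Th 0 x = 1 / x ^ (1 / 2 : ℝ) * Th 0 x⁻¹ := by
  have := Real.tsum_exp_neg_mul_int_sq hx
  unfold Th
  convert this using 3
  · simp; ring
  · ext k; simp; ring

noncomputable def G (t : ℝ) : ℝ := Real.log (Th 0 (Real.exp t)) + t / 4

lemma G_even (t : ℝ) : G (-t) = G t := by
  have h := Th_inv (Real.exp_pos t)
  have p := Th_zero_ge (inv_pos.2 (Real.exp_pos t))
  unfold G
  rw [h, Real.log_mul (by positivity) (by positivity), Real.exp_neg, one_div, Real.log_inv,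
    Real.log_rpow (Real.exp_pos t), Real.log_exp]
  ring

lemma G_deriv (t : ℝ) : HasDerivAt G
    (-(Real.exp t * Th 1 (Real.exp t)) / Th 0 (Real.exp t) + 1 / 4) t := by
  have p := Th_zero_ge (Real.exp_pos t)
  have h := ((Th_hasDerivAt 0 (Real.exp_pos t)).comp t (Real.hasDerivAt_exp t)).log
    (by simp only [Function.comp]; positivity)
  refine (h.add ((hasDerivAt_id t).div_const 4)).congr_deriv ?_
  simp only [Function.comp]; ring

lemma G_deriv2 (t : ℝ) : HasDerivAt (deriv G)
    (Real.exp t * ((Real.exp t * Th 2 (Real.exp t) - Th 1 (Real.exp t)) * Th 0 (Real.exp t)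
      - Real.exp t * Th 1 (Real.exp t) ^ 2) / Th 0 (Real.exp t) ^ 2) t := by
  have : deriv G = fun t => (-(Real.exp t * Th 1 (Real.exp t)) / Th 0 (Real.exp t) + 1 / 4) :=
    funext fun t => (G_deriv t).deriv
  rw [this]
  have p := Th_zero_ge (Real.exp_pos t)
  have h0 := ((Th_hasDerivAt 0 (Real.exp_pos t)).comp t (Real.hasDerivAt_exp t))
  have h1 := ((Th_hasDerivAt 1 (Real.exp_pos t)).comp t (Real.hasDerivAt_exp t))
  refine (((((Real.hasDerivAt_exp t).mul h1).neg).div h0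
    (by simp only [Function.comp]; positivity)).add_const (1 / 4)).congr_deriv ?_
  simp only [Function.comp, Pi.mul_apply, Pi.neg_apply]; ring

lemma G_deriv2_pos (t : ℝ) : 0 < deriv^[2] G t := by
  have hpos : ∀ t : ℝ, 0 ≤ t → 0 < deriv^[2] G t := by
    intro t ht
    have p := Th_zero_ge (Real.exp_pos t)
    have k := key (Real.one_le_exp ht)
    simp only [Function.iterate_succ, Function.iterate_zero, Function.comp, id]
    rw [(G_deriv2 t).deriv]
    have := sub_pos.2 k
    positivity
  rcases le_total 0 t with h | h
  · exact hpos t h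
  · have h1 := hpos (-t) (by linarith)
    have h2 := iteratedDeriv_comp_neg 2 G t
    have h3 : (fun x => G (-x)) = G := funext G_even
    rw [h3] at h2
    rw [← iteratedDeriv_eq_iterate] at h1 ⊢
    rw [h2]; simpa using h1

lemma G_strict : StrictConvexOn ℝ Set.univ G :=
  strictConvexOn_univ_of_deriv2_pos
    (continuous_iff_continuousAt.2 fun t => (G_deriv t).continuousAt) G_deriv2_pos

theorem theta3_mul_div_ge (r s : ℝ) (hr : 0 < r) (hs : 0 < s) :
    theta3 r ^ 2 ≤ theta3 (r * s) * theta3 (r / s) ∧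
    (theta3 (r * s) * theta3 (r / s) = theta3 r ^ 2 ↔ s = 1) := by
  have key2 : s ≠ 1 → theta3 r ^ 2 < theta3 (r * s) * theta3 (r / s) := by
    intro hs1
    have hl : Real.log s ≠ 0 := Real.log_ne_zero_of_pos_of_ne_one hs hs1
    have h := G_strict.2 (Set.mem_univ (Real.log r + Real.log s))
      (Set.mem_univ (Real.log r - Real.log s)) (fun h => hl (by linarith))
      (by norm_num : (0 : ℝ) < 1 / 2) (by norm_num : (0 : ℝ) < 1 / 2) (by norm_num)
    have e : (1 / 2 : ℝ) • (Real.log r + Real.log s) + (1 / 2 : ℝ) • (Real.log r - Real.log s)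
        = Real.log r := by simp only [smul_eq_mul]; ring
    rw [e] at h
    simp only [smul_eq_mul, G, Real.exp_add, Real.exp_sub, Real.exp_log hr, Real.exp_log hs] at h
    have p0 := Th_zero_ge hr
    have p1 := Th_zero_ge (mul_pos hr hs)
    have p2 := Th_zero_ge (div_pos hr hs)
    simp only [theta3_eq]
    rw [← Real.log_lt_log_iff (by positivity) (by positivity), Real.log_mul (by positivity)
      (by positivity), Real.log_pow]
    push_cast
    linarith
  by_cases h : s = 1
  · subst h; simp [sq]
  · exact ⟨(key2 h).le, fun e => absurd e (key2 h).ne', fun e => absurd e h⟩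
end

section
/- For all real numbers r > 0 and s > 0, one has θ₄(rs) · θ₄(r/s) ≤ θ₄(r)², with equality if and only if s = 1. -/
noncomputable def theta4 (s : ℝ) : ℝ := ∑' k : ℤ, (-1 : ℝ) ^ k * Real.exp (-Real.pi * (k : ℝ) ^ 2 * s)

namespace T4

noncomputable def P (q : ℝ) (n : ℕ) : ℝ := ∏ j ∈ Finset.range n, (1 - q ^ (j+1)) / (1 + q ^ (j+1))

noncomputable def F (q : ℝ) (n s : ℕ) : ℝ :=
  (-1) ^ s * (P q n / P q s) * (2 / (1 + q ^ s)) * q ^ (s * (n + 1))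

lemma P_succ (q : ℝ) (n : ℕ) : P q (n+1) = P q n * ((1 - q ^ (n+1)) / (1 + q ^ (n+1))) := by
  rw [P, Finset.prod_range_succ, P]

lemma fac_pos {q : ℝ} (h0 : 0 < q) (h1 : q < 1) (n : ℕ) :
    0 < (1 - q ^ (n+1)) / (1 + q ^ (n+1)) := by
  have : q ^ (n+1) < 1 := pow_lt_one₀ h0.le h1 (by omega)
  have : 0 < q ^ (n+1) := by positivity
  apply div_pos <;> linarith

lemma P_pos {q : ℝ} (h0 : 0 < q) (h1 : q < 1) (n : ℕ) : 0 < P q n :=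
  Finset.prod_pos fun j _ => fac_pos h0 h1 j

lemma tele {q : ℝ} (h0 : 0 < q) (h1 : q < 1) (n m : ℕ) :
    ∑ s ∈ Finset.range (m+1), (F q (n+1) s - F q n s) =
      - (2 * P q n / (1 + q ^ (n+1))) * ((-1) ^ m * q ^ ((m+1) * (n+1)) / P q m) := by
  induction m with
  | zero =>
    have h2 : 0 < q ^ (n+1) := by positivity
    have hp : P q 0 = 1 := by simp [P]
    simp only [zero_add, Finset.sum_range_one, F, P_succ q n, hp]
    simp
    field_simp
    ring
  | succ m ih =>
    rw [Finset.sum_range_succ, ih]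
    have hm := P_pos h0 h1 m
    have hn := P_pos h0 h1 n
    have h2 : 0 < q ^ (n+1) := by positivity
    have h3 : 0 < q ^ (m+1) := by positivity
    have h4 : q ^ (m+1) < 1 := pow_lt_one₀ h0.le h1 (by omega)
    have h5 : 1 - q ^ (m+1) ≠ 0 := by linarith
    simp only [F, P_succ]
    have e1 : q ^ ((m+1) * (n+1+1)) = q ^ ((m+1) * (n+1)) * q ^ (m+1) := by ring
    have e2 : q ^ ((m+1+1) * (n+1)) = q ^ ((m+1) * (n+1)) * q ^ (n+1) := by ring
    rw [e1, e2, pow_succ (-1 : ℝ) m]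
    generalize q ^ ((m+1) * (n+1)) = w
    generalize q ^ (m+1) = u at *
    generalize q ^ (n+1) = v at *
    generalize (-1 : ℝ) ^ m = e
    field_simp
    ring

lemma shanks {q : ℝ} (h0 : 0 < q) (h1 : q < 1) (n : ℕ) :
    ∑ s ∈ Finset.range (n+1), F q n s =
      2 * (∑ s ∈ Finset.range (n+1), (-1) ^ s * q ^ (s ^ 2)) - 1 := by
  induction n with
  | zero => norm_num [F, P]
  | succ n ih =>
    have ht := tele h0 h1 n n
    rw [Finset.sum_sub_distrib, ih] at ht
    rw [Finset.sum_range_succ, Finset.sum_range_succ _ (n+1), sub_eq_iff_eq_add.1 ht]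
    have hn := P_pos h0 h1 n
    have hn1 := P_pos h0 h1 (n+1)
    have h2 : 0 < q ^ (n+1) := by positivity
    simp only [F]
    rw [div_self hn1.ne']
    have e1 : q ^ ((n+1) * (n+1+1)) = q ^ ((n+1)^2) * q ^ (n+1) := by ring
    have e2 : q ^ ((n+1) * (n+1)) = q ^ ((n+1)^2) := by ring
    rw [e1, e2, pow_succ (-1 : ℝ) n]
    generalize q ^ ((n+1) ^ 2) = w
    generalize q ^ (n+1) = u at *
    field_simp
    ring

lemma P_anti {q : ℝ} (h0 : 0 < q) (h1 : q < 1) : Antitone (P q) := by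
  apply antitone_nat_of_succ_le
  intro n
  rw [P_succ]
  have h2 : 0 < q ^ (n+1) := by positivity
  apply mul_le_of_le_one_right (P_pos h0 h1 n).le
  rw [div_le_one (by positivity)]
  linarith

lemma bound {q : ℝ} (h0 : 0 < q) (h1 : q < 1) (n : ℕ) :
    |2 * (∑ s ∈ Finset.range (n+1), (-1) ^ s * q ^ (s ^ 2)) - 1 - P q n| ≤
      n * (2 * q ^ n) := by
  rw [← shanks h0 h1, Finset.sum_range_succ']
  have : F q n 0 = P q n := by
    have hp : P q 0 = 1 := by simp [P]
    simp only [F, hp]; norm_num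
  rw [this, add_sub_cancel_right]
  refine (Finset.abs_sum_le_sum_abs _ _).trans ?_
  calc _ ≤ ∑ s ∈ Finset.range n, (2 * q ^ n) := by
        apply Finset.sum_le_sum
        intro s hs
        have hs' : s + 1 ≤ n := by simpa using hs
        have hn := P_pos h0 h1 n
        have hsP := P_pos h0 h1 (s+1)
        have h2 : 0 < q ^ (s+1) := by positivity
        simp only [F, abs_mul, abs_pow, abs_neg, abs_one, one_pow, one_mul]
        rw [abs_of_pos h0, abs_of_pos (div_pos hn hsP),
          abs_of_pos (by positivity : 0 < 2 / (1 + q ^ (s+1)))]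
        have b1 : P q n / P q (s+1) ≤ 1 := (div_le_one hsP).2 (P_anti h0 h1 hs')
        have b2 : 2 / (1 + q ^ (s+1)) ≤ 2 := by
          rw [div_le_iff₀ (by positivity)]; linarith
        have b3 : q ^ ((s+1) * (n+1)) ≤ q ^ n :=
          pow_le_pow_of_le_one h0.le h1.le (by nlinarith)
        calc _ ≤ 1 * 2 * q ^ n := by gcongr
          _ = _ := by ring
    _ = _ := by simp

lemma term_eq (s : ℝ) (k : ℕ) :
    Real.exp (-Real.pi * (k : ℝ) ^ 2 * s) = Real.exp (-Real.pi * s) ^ (k ^ 2) := by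
  rw [← Real.exp_nat_mul]; push_cast; ring_nf

lemma summ {s : ℝ} (hs : 0 < s) :
    Summable fun k : ℤ => (-1 : ℝ) ^ k * Real.exp (-Real.pi * (k : ℝ) ^ 2 * s) := by
  have h0 := Real.exp_pos (-Real.pi * s)
  have h1 : Real.exp (-Real.pi * s) < 1 := by
    rw [Real.exp_lt_one_iff]; have := mul_pos Real.pi_pos hs; linarith
  have key : Summable fun k : ℕ => (-1 : ℝ) ^ k * Real.exp (-Real.pi * s) ^ (k ^ 2) := by
    apply Summable.of_norm_bounded (summable_geometric_of_lt_one h0.le h1)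
    intro k
    simp only [norm_mul, norm_pow, norm_neg, norm_one, one_pow, one_mul, Real.norm_eq_abs, Real.abs_exp]
    exact pow_le_pow_of_le_one h0.le h1.le (by nlinarith [Nat.le_self_pow (n := 2) (by norm_num) k])
  apply Summable.of_nat_of_neg
  · refine key.congr fun k => ?_
    rw [← term_eq]; simp
  · refine key.congr fun k => ?_
    rw [← term_eq]
    have : ((-1 : ℝ) ^ k)⁻¹ = (-1) ^ k := by rw [← inv_pow]; norm_num
    simp [this]

lemma tendsto_P {s : ℝ} (hs : 0 < s) :
    Filter.Tendsto (P (Real.exp (-Real.pi * s))) Filter.atTop (nhds (theta4 s)) := by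
  have h0 := Real.exp_pos (-Real.pi * s)
  have h1 : Real.exp (-Real.pi * s) < 1 := by
    rw [Real.exp_lt_one_iff]; have := mul_pos Real.pi_pos hs; linarith
  have A := ((summ hs).hasSum.nat_add_neg.tendsto_sum_nat.comp (Filter.tendsto_add_atTop_nat 1)).sub_const 1
  have B : Filter.Tendsto (fun n : ℕ => (n : ℝ) * (2 * Real.exp (-Real.pi * s) ^ n))
      Filter.atTop (nhds 0) := by
    have := (tendsto_self_mul_const_pow_of_lt_one h0.le h1).const_mul 2
    simp only [mul_zero] at this
    refine this.congr fun n => by ring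
  have C := squeeze_zero_norm (f := fun n : ℕ => 2 * (∑ k ∈ Finset.range (n+1), (-1) ^ k * Real.exp (-Real.pi * s) ^ (k ^ 2)) - 1 - P (Real.exp (-Real.pi * s)) n) (fun n => bound h0 h1 n) B
  have D := A.sub C
  simp only [Int.cast_zero] at D
  convert D using 2
  · simp only [Function.comp]
    rw [Finset.mul_sum]
    have : ∀ k : ℕ,
      ((-1 : ℝ) ^ (k:ℤ) * Real.exp (-Real.pi * ((k:ℤ) : ℝ) ^ 2 * s) +
      (-1 : ℝ) ^ (-(k:ℤ)) * Real.exp (-Real.pi * ((-(k:ℤ) : ℤ) : ℝ) ^ 2 * s))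
       = 2 * ((-1) ^ k * Real.exp (-Real.pi * s) ^ (k ^ 2)) := by
      intro k
      rw [← term_eq]
      have : ((-1 : ℝ) ^ k)⁻¹ = (-1) ^ k := by rw [← inv_pow]; norm_num
      simp [this]; ring
    rw [Finset.sum_congr rfl fun k _ => this k]
    ring
  · simp [theta4]

lemma theta_pos {s : ℝ} (hs : 0 < s) : 0 < theta4 s := by
  have h0 := Real.exp_pos (-Real.pi * s)
  have h1 : Real.exp (-Real.pi * s) < 1 := by
    rw [Real.exp_lt_one_iff]; have := mul_pos Real.pi_pos hs; linarith
  have hT := tendsto_P hs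
  generalize Real.exp (-Real.pi * s) = q at *
  have hge : 0 ≤ theta4 s := ge_of_tendsto' hT fun n => (P_pos h0 h1 n).le
  refine lt_of_le_of_ne hge (Ne.symm ?_)
  have hsum : Summable fun n : ℕ => ‖(1 - q ^ (n+1)) / (1 + q ^ (n+1)) - 1‖ := by
    apply Summable.of_nonneg_of_le (fun _ => norm_nonneg _) (fun n => ?_)
      ((summable_geometric_of_lt_one h0.le h1).mul_left (2*q))
    have h2 : 0 < q ^ (n+1) := by positivity
    have : (1 - q ^ (n+1)) / (1 + q ^ (n+1)) - 1 = - (2 * q ^ (n+1) / (1 + q ^ (n+1))) := by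
      field_simp; ring
    rw [this, norm_neg, Real.norm_eq_abs, abs_of_pos (by positivity), div_le_iff₀ (by positivity)]
    have : 2 * q * q ^ n = 2 * q ^ (n+1) := by ring
    rw [this]
    nlinarith
  have hne := tprod_one_add_ne_zero_of_summable
    (f := fun n : ℕ => (1 - q ^ (n+1)) / (1 + q ^ (n+1)) - 1)
    (fun n => by simpa using (fac_pos h0 h1 n).ne') hsum
  have hm := (multipliable_one_add_of_summable hsum).hasProd.tendsto_prod_nat
  simp only [add_sub_cancel] at hm hne
  rw [tendsto_nhds_unique hT hm]
  exact hne

lemma cosh_lt {A B p : ℝ} (h : 2 * p ^ 2 = A ^ 2 + B ^ 2) (hne : A ^ 2 ≠ B ^ 2) :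
    2 * Real.cosh p < Real.cosh A + Real.cosh B := by
  have hp := (Real.hasSum_cosh p).mul_left 2
  have hAB := (Real.hasSum_cosh A).add (Real.hasSum_cosh B)
  have hp2 : p ^ 2 = (A ^ 2 + B ^ 2) / 2 := by linarith
  refine hasSum_lt (i := 2) (fun n => ?_) ?_ hp hAB
  · rw [← add_div, ← mul_div_assoc]
    apply div_le_div_of_nonneg_right _ (by positivity)
    rw [pow_mul, pow_mul, pow_mul, hp2]
    have := add_pow_le (sq_nonneg A) (sq_nonneg B) n
    rcases n with _ | n
    · norm_num
    · rw [div_pow, pow_succ 2 n, ← mul_div_assoc, div_le_iff₀ (by positivity)]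
      simp only [Nat.add_sub_cancel] at this
      nlinarith
  · rw [← add_div, ← mul_div_assoc]
    apply div_lt_div_of_pos_right _ (by positivity)
    rw [pow_mul, pow_mul, pow_mul, hp2]
    have : 0 < (A^2 - B^2)^2 := by have := sub_ne_zero.2 hne; positivity
    nlinarith

lemma key {a s : ℝ} (ha : 0 < a) (hs : 0 < s) (h1 : s ≠ 1) :
    Real.tanh (a * s) * Real.tanh (a / s) < Real.tanh a ^ 2 := by
  have hc := cosh_lt (A := 2 * a + (a * s - a / s)) (B := 2 * a - (a * s - a / s))
    (p := a * s + a / s) (by field_simp; ring) (by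
      intro h
      have h' : 8 * a * (a * s - a / s) = 0 := by linarith
      have : s ^ 2 = 1 := by
        have ha2 : 0 < 8 * a ^ 2 := by positivity
        have h2 : 8 * a ^ 2 * (s ^ 2 - 1) = 0 := by field_simp at h'; linarith
        rcases mul_eq_zero.1 h2 with h3 | h3 <;> linarith
      apply h1; nlinarith)
  have e1 : Real.cosh (2 * a + (a * s - a / s)) + Real.cosh (2 * a - (a * s - a / s))
    = 2 * (Real.cosh (2*a) * Real.cosh (a * s - a / s)) := by
    rw [Real.cosh_add, Real.cosh_sub (2 * a)]; ring
  rw [e1, Real.cosh_add, Real.cosh_sub, Real.cosh_two_mul] at hc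
  have hsq := Real.cosh_sq a
  rw [Real.tanh_eq_sinh_div_cosh, Real.tanh_eq_sinh_div_cosh, Real.tanh_eq_sinh_div_cosh,
    div_mul_div_comm, div_pow]
  have c1 := Real.cosh_pos (a * s)
  have c2 := Real.cosh_pos (a / s)
  have c3 := Real.cosh_pos a
  rw [div_lt_div_iff₀ (by positivity) (by positivity)]
  rw [hsq] at hc ⊢
  nlinarith

lemma fac_eq (s : ℝ) (n : ℕ) :
    (1 - Real.exp (-Real.pi * s) ^ (n+1)) / (1 + Real.exp (-Real.pi * s) ^ (n+1))
      = Real.tanh ((Real.pi * (n+1) / 2) * s) := by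
  rw [Real.tanh_eq, ← Real.exp_nat_mul]
  have e : Real.exp (((n + 1 : ℕ) : ℝ) * (-Real.pi * s)) =
     Real.exp (-((Real.pi * (n+1) / 2) * s)) / Real.exp ((Real.pi * (n+1) / 2) * s) := by
    rw [← Real.exp_sub]; push_cast; ring_nf
  rw [e]
  have := Real.exp_pos ((Real.pi * (n+1) / 2) * s)
  have := Real.exp_pos (-((Real.pi * (n+1) / 2) * s))
  field_simp

lemma strict {r s : ℝ} (hr : 0 < r) (hs : 0 < s) (h1 : s ≠ 1) :
    theta4 (r * s) * theta4 (r / s) < theta4 r ^ 2 := by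
  have hk : ∀ n : ℕ, Real.tanh ((Real.pi * (n+1) / 2) * (r * s)) *
      Real.tanh ((Real.pi * (n+1) / 2) * (r / s)) < Real.tanh ((Real.pi * (n+1) / 2) * r) ^ 2 := by
    intro n
    have := key (a := (Real.pi * (n+1) / 2) * r) (s := s) (by positivity) hs h1
    rwa [mul_assoc _ r s, mul_div_assoc _ r s] at this
  have ht : ∀ (x : ℝ) (n : ℕ), 0 < x → 0 < Real.tanh ((Real.pi * (n+1) / 2) * x) := by
    intro x n hx
    rw [Real.tanh_eq_sinh_div_cosh]
    exact div_pos (Real.sinh_pos_iff.2 (by positivity)) (Real.cosh_pos _)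
  set x := Real.tanh ((Real.pi * ((0:ℕ)+1) / 2) * (r * s)) *
      Real.tanh ((Real.pi * ((0:ℕ)+1) / 2) * (r / s))
  set y := Real.tanh ((Real.pi * ((0:ℕ)+1) / 2) * r) ^ 2 with hy
  have hxy : x < y := hk 0
  have hy0 : 0 < y := by have := ht r 0 hr; positivity
  have hfin : ∀ n : ℕ, P (Real.exp (-Real.pi * (r * s))) (n+1) * P (Real.exp (-Real.pi * (r / s))) (n+1)
      * y ≤ x * P (Real.exp (-Real.pi * r)) (n+1) ^ 2 := by
    intro n
    simp only [P, fac_eq]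
    rw [Finset.prod_range_succ', Finset.prod_range_succ', Finset.prod_range_succ']
    have hle : (∏ k ∈ Finset.range n, Real.tanh ((Real.pi * ((k+1:ℕ)+1) / 2) * (r * s))) *
        (∏ k ∈ Finset.range n, Real.tanh ((Real.pi * ((k+1:ℕ)+1) / 2) * (r / s))) ≤
        (∏ k ∈ Finset.range n, Real.tanh ((Real.pi * ((k+1:ℕ)+1) / 2) * r)) ^ 2 := by
      rw [← Finset.prod_mul_distrib, ← Finset.prod_pow]
      apply Finset.prod_le_prod
      · intro k _
        exact (mul_pos (ht _ _ (by positivity)) (ht _ _ (by positivity))).le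
      · intro k _
        exact (hk (k+1)).le
    have hx0 : 0 < x := mul_pos (ht _ _ (by positivity)) (ht _ _ (by positivity))
    have := mul_le_mul_of_nonneg_left hle (mul_pos hx0 hy0).le
    calc _ = x * y * _ := by simp only [x]; ring
      _ ≤ _ := this
      _ = _ := by rw [hy]; ring
  have hlim := le_of_tendsto_of_tendsto'
    ((((tendsto_P (mul_pos hr hs)).mul (tendsto_P (div_pos hr hs))).mul_const y).comp
      (Filter.tendsto_add_atTop_nat 1))
    ((((tendsto_P hr).pow 2).const_mul x).comp (Filter.tendsto_add_atTop_nat 1)) hfin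
  have hp : 0 < theta4 r ^ 2 := pow_pos (theta_pos hr) 2
  have : x * theta4 r ^ 2 < y * theta4 r ^ 2 := mul_lt_mul_of_pos_right hxy hp
  nlinarith

end T4

theorem theta4_mul_div_le (r s : ℝ) (hr : 0 < r) (hs : 0 < s) :
    theta4 (r * s) * theta4 (r / s) ≤ theta4 r ^ 2 ∧
    (theta4 (r * s) * theta4 (r / s) = theta4 r ^ 2 ↔ s = 1) := by
  by_cases h : s = 1
  · subst h
    simp [sq]
  · have := T4.strict hr hs h
    exact ⟨this.le, fun e => absurd e this.ne, fun e => absurd e h⟩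
end

section
/- For every s > 0, the inequalities θ₃''(s)·θ₃(s) − θ₃'(s)² > −θ₃'(s)·θ₃(s)/s > 0 hold (refined logarithmic convexity of θ₃). -/
noncomputable def thC (k : ℤ) : ℝ := Real.pi * (k : ℝ) ^ 2

noncomputable def thF (m : ℕ) (t : ℝ) : ℝ := ∑' k : ℤ, thC k ^ m * Real.exp (-(thC k * t))

lemma thC_nonneg (k : ℤ) : 0 ≤ thC k := by unfold thC; positivity

lemma thC_zero : thC 0 = 0 := by simp [thC]

lemma thC_ge (k : ℤ) (hk : k ≠ 0) : Real.pi ≤ thC k := by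
  unfold thC
  have h : (1 : ℝ) ≤ (k : ℝ) ^ 2 := by
    have : (1 : ℤ) ≤ k ^ 2 := by have := sq_pos_of_ne_zero hk; omega
    exact_mod_cast this
  nlinarith [Real.pi_pos]

lemma thC_pos (k : ℤ) (hk : k ≠ 0) : 0 < thC k := Real.pi_pos.trans_le (thC_ge k hk)

lemma thC_inv_summable : Summable (fun k : ℤ => (thC k)⁻¹) := by
  have h : Summable (fun k : ℤ => 1 / (k : ℝ) ^ 2) :=
    Real.summable_one_div_int_pow.2 (by norm_num)
  refine (h.mul_left (Real.pi⁻¹)).congr ?_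
  intro k
  simp [thC, mul_inv, mul_comm]

lemma th_exp_bound (p : ℕ) (x : ℝ) (hx : 0 ≤ x) : x ^ p * Real.exp (-x) ≤ p.factorial := by
  have h := Real.pow_div_factorial_le_exp x hx p
  rw [div_le_iff₀ (by positivity)] at h
  rw [Real.exp_neg, ← div_eq_mul_inv, div_le_iff₀ (Real.exp_pos x)]
  linarith

lemma th_bound (m : ℕ) (a t : ℝ) (ha : 0 < a) (hat : a ≤ t) (k : ℤ) (hk : k ≠ 0) :
    thC k ^ m * Real.exp (-(thC k * t)) ≤ ((m + 1).factorial / a ^ (m + 1)) * (thC k)⁻¹ := by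
  have hc := thC_pos k hk
  have h1 := th_exp_bound (m + 1) (thC k * a) (by positivity)
  have h2 : Real.exp (-(thC k * t)) ≤ Real.exp (-(thC k * a)) := by
    apply Real.exp_le_exp.2; nlinarith
  rw [← div_eq_mul_inv, le_div_iff₀ hc, le_div_iff₀ (by positivity)]
  calc _ = (thC k * a) ^ (m + 1) * Real.exp (-(thC k * t)) := by ring
    _ ≤ (thC k * a) ^ (m + 1) * Real.exp (-(thC k * a)) := by gcongr
    _ ≤ _ := h1

lemma th_summable (m : ℕ) (t : ℝ) (ht : 0 < t) :
    Summable (fun k : ℤ => thC k ^ m * Real.exp (-(thC k * t))) := by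
  refine Summable.of_norm_bounded_eventually
    (thC_inv_summable.mul_left ((m + 1).factorial / t ^ (m + 1) : ℝ)) ?_
  have : ∀ᶠ k : ℤ in Filter.cofinite, k ≠ 0 := by
    exact (Set.finite_singleton (0 : ℤ)).subset (fun k hk => by simpa using hk) 
  filter_upwards [this] with k hk
  have := thC_nonneg k
  rw [Real.norm_of_nonneg (by positivity)]
  exact th_bound m t t ht le_rfl k hk

lemma thF_hasDerivAt (m : ℕ) (t : ℝ) (ht : 0 < t) :
    HasDerivAt (thF m) (-thF (m + 1) t) t := by
  have key := hasDerivAt_tsum_of_isPreconnected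
    (g := fun (k : ℤ) (x : ℝ) => thC k ^ m * Real.exp (-(thC k * x)))
    (g' := fun (k : ℤ) (x : ℝ) => -(thC k ^ (m + 1) * Real.exp (-(thC k * x))))
    (t := Set.Ioi (t / 2)) (y₀ := t) (y := t)
    (thC_inv_summable.mul_left ((m + 1 + 1).factorial / (t / 2) ^ (m + 1 + 1) : ℝ))
    isOpen_Ioi isPreconnected_Ioi ?_ ?_ (by simp [ht]) (th_summable m t ht) (by simp [ht])
  · rw [tsum_neg] at key
    exact key
  · intro k y _
    have h : HasDerivAt (fun x : ℝ => -(thC k * x)) (-(thC k * 1)) y :=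
      ((hasDerivAt_id y).const_mul (thC k)).neg
    refine (h.exp.const_mul (thC k ^ m)).congr_deriv ?_
    ring
  · intro k y hy
    have hc := thC_nonneg k
    rw [norm_neg, Real.norm_of_nonneg (by positivity)]
    by_cases hk : k = 0
    · subst hk; simp [thC_zero]
    · exact th_bound (m + 1) (t / 2) y (by positivity) (le_of_lt hy) k hk

lemma thF_zero_eq : theta3 = thF 0 := by
  funext s
  simp [theta3, thF, thC]

lemma thF_one_pos (t : ℝ) (ht : 0 < t) : 0 < thF 1 t := by
  refine (th_summable 1 t ht).tsum_pos (fun k => ?_) 1 ?_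
  · have := thC_nonneg k; positivity
  · have := thC_pos 1 one_ne_zero; positivity

lemma thF_zero_ge (t : ℝ) (ht : 0 < t) : 1 ≤ thF 0 t := by
  have := (th_summable 0 t ht).le_tsum 0 (fun k _ => by positivity)
  simpa [thC_zero, thF] using this

lemma thF_two_ge (t : ℝ) (ht : 0 < t) : Real.pi * thF 1 t ≤ thF 2 t := by
  unfold thF
  rw [← tsum_mul_left]
  refine ((th_summable 1 t ht).mul_left _).tsum_le_tsum (fun k => ?_) (th_summable 2 t ht)
  by_cases hk : k = 0
  · subst hk; simp [thC_zero]
  · have h1 := thC_ge k hk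
    have h2 := thC_pos k hk
    rw [← mul_assoc]
    gcongr
    nlinarith

lemma thF_one_lt (t : ℝ) (ht : 1 ≤ t) : thF 1 t < 2 := by
  have hpi := Real.pi_pos
  have hz : HasSum (fun k : ℤ => 6 / Real.pi ^ 2 * (1 / (k : ℝ) ^ 4))
      (6 / Real.pi ^ 2 * (Real.pi ^ 4 / 90 + Real.pi ^ 4 / 90)) := by
    apply HasSum.mul_left
    have h := hasSum_zeta_four
    have h' : HasSum (fun n : ℕ => 1 / (((n : ℕ) : ℝ) + 1) ^ 4) (Real.pi ^ 4 / 90) := by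
      have := (hasSum_nat_add_iff' (f := fun n : ℕ => (1 : ℝ) / (n : ℝ) ^ 4) 1).2 h
      simpa using this
    refine HasSum.of_nat_of_neg_add_one (f := fun k : ℤ => 1 / (k : ℝ) ^ 4) ?_ ?_
    · simpa using h
    · refine (congrArg (fun f : ℕ → ℝ => HasSum f (Real.pi ^ 4 / 90)) (funext fun n => ?_)).mpr h'
      have e : (((-((n : ℤ) + 1) : ℤ)) : ℝ) = -((n : ℝ) + 1) := by push_cast; ring
      simp only [e]
      rw [Even.neg_pow (by decide)]
  have hle : thF 1 t ≤ 6 / Real.pi ^ 2 * (Real.pi ^ 4 / 90 + Real.pi ^ 4 / 90) := by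
    rw [← hz.tsum_eq]
    refine (th_summable 1 t (by linarith)).tsum_le_tsum (fun k => ?_) hz.summable
    by_cases hk : k = 0
    · subst hk; simp [thC_zero]
    · have hc := thC_pos k hk
      have h1 := th_exp_bound 3 (thC k) hc.le
      have h2 : Real.exp (-(thC k * t)) ≤ Real.exp (-(thC k)) := by
        apply Real.exp_le_exp.2; nlinarith
      have h3 : 6 / Real.pi ^ 2 * (1 / (k : ℝ) ^ 4) = 6 / thC k ^ 2 := by
        unfold thC
        have : (k : ℝ) ≠ 0 := by exact_mod_cast hk
        field_simp
      rw [h3, le_div_iff₀ (by positivity)]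
      calc _ = thC k ^ 3 * Real.exp (-(thC k * t)) := by ring
        _ ≤ thC k ^ 3 * Real.exp (-(thC k)) := by gcongr
        _ ≤ _ := by simpa [Nat.factorial] using h1
  have e : 6 / Real.pi ^ 2 * (Real.pi ^ 4 / 90 + Real.pi ^ 4 / 90) = 2 / 15 * Real.pi ^ 2 := by
    field_simp; ring
  rw [e] at hle
  nlinarith [Real.pi_lt_d2]

/-- numerator of the derivative of the Euler log derivative -/
noncomputable def thN (s : ℝ) : ℝ :=
  s * (thF 2 s * thF 0 s - thF 1 s ^ 2) - thF 1 s * thF 0 s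

lemma thN_pos_of_one_le (s : ℝ) (hs : 1 ≤ s) : 0 < thN s := by
  have h0 : 0 < s := by linarith
  have hA := thF_one_pos s h0
  have hA2 := thF_one_lt s hs
  have hT := thF_zero_ge s h0
  have hB := thF_two_ge s h0
  have hpi := Real.pi_gt_three
  unfold thN
  have h1 : s * (Real.pi * thF 1 s * thF 0 s) ≤ s * (thF 2 s * thF 0 s) := by gcongr
  have h2 : s * thF 1 s < (s * Real.pi - 1) * thF 0 s := by
    have : s * thF 1 s < s * 2 := by gcongr
    have : s * 2 ≤ s * Real.pi - 1 := by nlinarith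
    nlinarith
  have h3 := mul_lt_mul_of_pos_left h2 hA
  nlinarith

noncomputable def thL (s : ℝ) : ℝ := s * thF 1 s / thF 0 s

lemma thL_hasDerivAt (s : ℝ) (hs : 0 < s) : HasDerivAt thL (-(thN s) / thF 0 s ^ 2) s := by
  have hT := thF_zero_ge s hs
  have h := ((hasDerivAt_id s).mul (thF_hasDerivAt 1 s hs)).div (thF_hasDerivAt 0 s hs)
    (by positivity)
  refine h.congr_deriv ?_
  simp [thN]
  ring

lemma thF_func (s : ℝ) (hs : 0 < s) : thF 0 s = s ^ (-(1 / 2) : ℝ) * thF 0 s⁻¹ := by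
  have h := Real.tsum_exp_neg_mul_int_sq hs
  rw [Real.rpow_neg hs.le, ← one_div]
  simp only [thF, thC, pow_zero, one_mul]
  convert h using 3
  · congr 1; ring
  · congr 1; funext k; congr 1; ring

lemma thL_func (s : ℝ) (hs : 0 < s) : thL s = 1 / 2 - thL s⁻¹ := by
  have hT := thF_zero_ge s hs
  have hT' := thF_zero_ge s⁻¹ (by positivity)
  have h1 := thF_hasDerivAt 0 s hs
  have h2 : HasDerivAt (fun x : ℝ => x ^ (-(1 / 2) : ℝ) * thF 0 x⁻¹) _ s :=
    (Real.hasDerivAt_rpow_const (p := (-(1 / 2) : ℝ)) (Or.inl hs.ne')).mul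
      ((thF_hasDerivAt 0 s⁻¹ (by positivity)).comp s (hasDerivAt_inv hs.ne'))
  have h3 : thF 0 =ᶠ[nhds s] (fun x : ℝ => x ^ (-(1 / 2) : ℝ) * thF 0 x⁻¹) := by
    filter_upwards [lt_mem_nhds hs] with x hx using thF_func x hx
  have h4 := h1.unique (h2.congr_of_eventuallyEq h3)
  have h5 := thF_func s hs
  rw [Real.rpow_sub_one hs.ne'] at h4
  have hr : 0 < s ^ (-(1 / 2) : ℝ) := Real.rpow_pos_of_pos hs _
  simp only [zero_add] at h4
  unfold thL
  have h6 : thF 1 s = s ^ (-(1 / 2) : ℝ) * (1 / 2 / s * thF 0 s⁻¹ - thF 1 s⁻¹ / s ^ 2) := by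
    have : thF 1 s = - -thF 1 s := by ring
    rw [this, h4]
    field_simp
    ring
  have hne : thF 0 s⁻¹ ≠ 0 := by positivity
  rw [h6, h5]
  generalize thF 0 s⁻¹ = T at *
  generalize thF 1 s⁻¹ = A at *
  field_simp
  try ring

lemma thN_pos (s : ℝ) (hs : 0 < s) : 0 < thN s := by
  rcases le_or_gt 1 s with h | h
  · exact thN_pos_of_one_le s h
  have hi : 0 < s⁻¹ := by positivity
  have hN := thN_pos_of_one_le s⁻¹ ((one_le_inv₀ hs).2 h.le)
  have hT := thF_zero_ge s hs
  have hT' := thF_zero_ge s⁻¹ hi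
  have h1 := thL_hasDerivAt s hs
  have h2 : HasDerivAt (fun x : ℝ => 1 / 2 - thL x⁻¹) _ s :=
    ((thL_hasDerivAt s⁻¹ hi).comp s (hasDerivAt_inv hs.ne')).const_sub (1 / 2)
  have h3 : thL =ᶠ[nhds s] (fun x : ℝ => 1 / 2 - thL x⁻¹) := by
    filter_upwards [lt_mem_nhds hs] with x hx using thL_func x hx
  have h4 := h1.unique (h2.congr_of_eventuallyEq h3)
  have h5 : thN s = thF 0 s ^ 2 * (thN s⁻¹ / thF 0 s⁻¹ ^ 2 * (s ^ 2)⁻¹) := by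
    have : thN s / thF 0 s ^ 2 = thN s⁻¹ / thF 0 s⁻¹ ^ 2 * (s ^ 2)⁻¹ := by
      rw [neg_div, neg_div] at h4
      linarith
    rw [← this]
    field_simp
  rw [h5]
  positivity

theorem theta3_refined_log_convex (s : ℝ) (hs : 0 < s) :
    -(deriv theta3 s * theta3 s) / s <
      deriv (deriv theta3) s * theta3 s - (deriv theta3 s) ^ 2 ∧
    0 < -(deriv theta3 s * theta3 s) / s := by
  have hd : ∀ x, 0 < x → deriv theta3 x = -thF 1 x := by
    intro x hx
    rw [thF_zero_eq]
    exact (thF_hasDerivAt 0 x hx).deriv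
  have hdd : deriv (deriv theta3) s = thF 2 s := by
    have h3 : deriv theta3 =ᶠ[nhds s] (fun x : ℝ => -thF 1 x) := by
      filter_upwards [lt_mem_nhds hs] with x hx using hd x hx
    rw [h3.deriv_eq, (thF_hasDerivAt 1 s hs).fun_neg.deriv]
    simp
  have hT := thF_zero_ge s hs
  have hA := thF_one_pos s hs
  have hN := thN_pos s hs
  unfold thN at hN
  rw [hdd, hd s hs, thF_zero_eq]
  constructor
  · rw [div_lt_iff₀ hs]
    nlinarith
  · apply div_pos _ hs
    nlinarith
end

section
/- For every s > 0, the inequalities θ₄''(s)·θ₄(s) − θ₄'(s)² < −θ₄'(s)·θ₄(s)/s < 0 hold (refined logarithmic concavity of θ₄). -/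
noncomputable def expSer (c a : ℕ → ℝ) (s : ℝ) : ℝ := ∑' k : ℕ, c k * Real.exp (-(a k) * s)

def ExpOK (c a : ℕ → ℝ) : Prop :=
  (∀ k, 0 ≤ a k) ∧ ∀ δ : ℝ, 0 < δ → Summable fun k => |c k| * Real.exp (-(a k) * δ)

lemma ExpOK.der {c a : ℕ → ℝ} (h : ExpOK c a) : ExpOK (fun k => -(a k) * c k) a := by
  refine ⟨h.1, fun δ hδ => ?_⟩
  have h2 := (h.2 (δ / 2) (by linarith)).mul_left (2 / δ)
  refine Summable.of_nonneg_of_le (fun k => by positivity) (fun k => ?_) h2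
  have ha := h.1 k
  have e1 : Real.exp (-(a k) * δ) = Real.exp (-(a k) * (δ / 2)) * Real.exp (-(a k * (δ / 2))) := by
    rw [← Real.exp_add]; congr 1; ring
  have e2 : a k * (δ / 2) * Real.exp (-(a k * (δ / 2))) ≤ 1 := by
    have := Real.add_one_le_exp (a k * (δ / 2))
    rw [Real.exp_neg, ← div_eq_mul_inv, div_le_one (Real.exp_pos _)]
    linarith
  have e3 : a k * Real.exp (-(a k * (δ / 2))) ≤ 2 / δ := by
    rw [le_div_iff₀ hδ]; nlinarith
  rw [abs_mul, abs_neg, abs_of_nonneg ha, e1]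
  calc a k * |c k| * (Real.exp (-(a k) * (δ / 2)) * Real.exp (-(a k * (δ / 2))))
      = (a k * Real.exp (-(a k * (δ / 2)))) * (|c k| * Real.exp (-(a k) * (δ / 2))) := by ring
    _ ≤ _ := by gcongr

lemma ExpOK.hasDerivAt {c a : ℕ → ℝ} (h : ExpOK c a) {s : ℝ} (hs : 0 < s) :
    HasDerivAt (expSer c a) (expSer (fun k => -(a k) * c k) a s) s := by
  have hs2 : s / 2 < s := by linarith
  refine hasDerivAt_tsum_of_isPreconnected (t := Set.Ioi (s / 2)) (y₀ := s)
    (h.der.2 (s / 2) (by linarith)) isOpen_Ioi isPreconnected_Ioi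
    (g := fun k z => c k * Real.exp (-(a k) * z))
    (g' := fun k z => -(a k) * c k * Real.exp (-(a k) * z)) ?_ ?_ hs2 ?_ hs2
  · intro k y _
    have := ((hasDerivAt_id y).const_mul (-(a k))).exp.const_mul (c k)
    convert! this using 1
    simp; ring
  · intro k y hy
    have hy' : s / 2 < y := hy
    rw [norm_mul, Real.norm_eq_abs, Real.norm_eq_abs, abs_of_pos (Real.exp_pos _)]
    have := h.1 k
    gcongr ?_ * Real.exp ?_
    nlinarith
  · refine Summable.of_norm ?_
    have := h.2 s hs
    simpa [norm_mul, Real.norm_eq_abs] using this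

lemma expOK_of {c a : ℕ → ℝ} (hc : ∀ k, |c k| ≤ 1) (ha : ∀ k : ℕ, (k : ℝ) ≤ a k) : ExpOK c a := by
  refine ⟨fun k => (Nat.cast_nonneg k).trans (ha k), fun δ hδ => ?_⟩
  have := (Real.summable_exp_nat_mul_iff (a := -δ)).2 (by linarith)
  refine Summable.of_nonneg_of_le (fun k => by positivity) (fun k => ?_) this
  calc |c k| * Real.exp (-(a k) * δ) ≤ 1 * Real.exp (k * -δ) := by
        gcongr ?_ * Real.exp ?_
        · exact hc k
        · nlinarith [ha k]
    _ = _ := one_mul _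

lemma tail_bound {f : ℕ → ℝ} {B r : ℝ} (hB : 0 ≤ B) (hr : 0 ≤ r) (hr2 : r ≤ 1 / 2)
    (hf : ∀ k, |f k| ≤ B * r ^ k) : |∑' k, f k - f 0| ≤ B * (2 * r) := by
  have hg : HasSum (fun k => B * r ^ k) (B * (1 - r)⁻¹) :=
    (hasSum_geometric_of_lt_one hr (by linarith)).mul_left B
  have hs : Summable f := Summable.of_norm_bounded hg.summable (fun k => by simpa using hf k)
  have h1 : ∑' k, f k - f 0 = ∑' k, f (k + 1) := by rw [hs.tsum_eq_zero_add]; ring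
  rw [h1]
  have hg' : HasSum (fun k => B * r * r ^ k) (B * r * (1 - r)⁻¹) :=
    (hasSum_geometric_of_lt_one hr (by linarith)).mul_left (B * r)
  have := tsum_of_norm_bounded (f := fun k => f (k + 1)) hg' (fun k => by
    have := hf (k + 1)
    rw [pow_succ] at this
    rw [Real.norm_eq_abs]; linarith)
  rw [Real.norm_eq_abs] at this
  refine this.trans ?_
  have : (1 - r)⁻¹ ≤ 2 := by
    rw [inv_le_comm₀ (by linarith) (by norm_num)]; linarith
  nlinarith [mul_nonneg hB hr]

/-! The two kernels -/

noncomputable def cA (k : ℕ) : ℝ := (-1) ^ (k + 1)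
noncomputable def aA (k : ℕ) : ℝ := Real.pi * ((k : ℝ) + 1) ^ 2
noncomputable def aB (k : ℕ) : ℝ := Real.pi * (((k : ℝ) + 1) * ((k : ℝ) + 2))

lemma okA : ExpOK cA aA := by
  refine expOK_of (fun k => by simp [cA]) (fun k => ?_)
  have := Real.pi_gt_three
  have hk : (0 : ℝ) ≤ k := Nat.cast_nonneg k
  unfold aA; nlinarith [sq_nonneg (k : ℝ)]

lemma okB : ExpOK (fun _ => 1) aB := by
  refine expOK_of (fun k => by simp) (fun k => ?_)
  have := Real.pi_gt_three
  have hk : (0 : ℝ) ≤ k := Nat.cast_nonneg k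
  unfold aB; nlinarith [sq_nonneg (k : ℝ)]

lemma theta4_eq_cosKernel {s : ℝ} (hs : 0 < s) :
    theta4 s = HurwitzZeta.cosKernel ((1 / 2 : ℝ) : UnitAddCircle) s := by
  have h := HurwitzZeta.hasSum_int_cosKernel (1 / 2) hs
  have h2 : HasSum (fun k : ℤ => (-1 : ℝ) ^ k * Real.exp (-Real.pi * (k : ℝ) ^ 2 * s))
      (HurwitzZeta.cosKernel ((1 / 2 : ℝ) : UnitAddCircle) s) := by
    rw [← Complex.hasSum_ofReal]
    refine h.congr_fun fun n => ?_
    have : Complex.exp (2 * Real.pi * Complex.I * ((1 / 2 : ℝ) : ℂ) * n) = (-1) ^ n := by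
      rw [← Complex.exp_pi_mul_I, ← Complex.exp_int_mul]
      congr 1; push_cast; ring
    rw [this]; push_cast; rfl
  exact h2.tsum_eq

lemma theta4_A {s : ℝ} (hs : 0 < s) : theta4 s = 1 + 2 * expSer cA aA s := by
  have h := (HurwitzZeta.hasSum_nat_cosKernel₀ (1 / 2) hs).tsum_eq
  rw [theta4_eq_cosKernel hs]
  have : ∑' n : ℕ, 2 * Real.cos (2 * Real.pi * (1 / 2) * (n + 1)) *
      Real.exp (-Real.pi * (n + 1) ^ 2 * s) = 2 * expSer cA aA s := by
    rw [expSer, ← tsum_mul_left]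
    congr 1; ext n
    have : Real.cos (2 * Real.pi * (1 / 2) * (n + 1)) = (-1) ^ (n + 1) := by
      rw [← Real.cos_nat_mul_pi]; congr 1; push_cast; ring
    rw [this, cA, aA, neg_mul, mul_assoc]
  linarith

lemma theta4_B {s : ℝ} (hs : 0 < s) : theta4 s =
    2 * s ^ (-(1 / 2) : ℝ) * Real.exp (-(Real.pi / 4) * s⁻¹) * (1 + expSer (fun _ => 1) aB s⁻¹) := by
  have hi : 0 < s⁻¹ := inv_pos.2 hs
  have h := HurwitzZeta.evenKernel_functional_equation ((1 / 2 : ℝ) : UnitAddCircle) s⁻¹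
  have h1 := HurwitzZeta.hasSum_int_evenKernel (1 / 2) hi
  have hsum : Summable fun k : ℕ => (1 : ℝ) * Real.exp (-(aB k) * s⁻¹) := by
    simpa using okB.2 _ hi
  set E := Real.exp (-(Real.pi / 4) * s⁻¹) with hE
  have h3 : HasSum (fun k : ℕ => Real.exp (-Real.pi * ((k : ℝ) + 1 / 2) ^ 2 * s⁻¹))
      (E * (1 + expSer (fun _ => 1) aB s⁻¹)) := by
    rw [← hasSum_nat_add_iff' 1]
    have := hsum.hasSum.mul_left E
    have e1 : (fun k : ℕ => Real.exp (-Real.pi * (((k + 1 : ℕ) : ℝ) + 1 / 2) ^ 2 * s⁻¹)) =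
        fun k => E * (1 * Real.exp (-(aB k) * s⁻¹)) := by
      ext k
      rw [one_mul, hE, ← Real.exp_add]; congr 1; unfold aB; push_cast; ring
    have e2 : Real.exp (-Real.pi * (((0 : ℕ) : ℝ) + 1 / 2) ^ 2 * s⁻¹) = E := by
      rw [hE]; congr 1; push_cast; ring
    rw [e1, Finset.sum_range_one, e2,
      show E * (1 + expSer (fun _ => 1) aB s⁻¹) - E = E * expSer (fun _ => 1) aB s⁻¹ by ring]
    exact this
  have h4 := HasSum.of_nat_of_neg_add_one
    (f := fun n : ℤ => Real.exp (-Real.pi * ((n : ℝ) + 1 / 2) ^ 2 * s⁻¹))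
    (by simpa only [Int.cast_natCast] using h3)
    (by
      refine h3.congr_fun fun k => ?_
      congr 1; push_cast; ring)
  have h5 := h1.unique h4
  rw [theta4_eq_cosKernel hs]
  rw [h5, show (1 : ℝ) / s⁻¹ = s by simp, Real.inv_rpow hs.le] at h
  rw [Real.rpow_neg hs.le]
  have hp : 0 < s ^ (1 / 2 : ℝ) := Real.rpow_pos_of_pos hs _
  field_simp at h ⊢
  linarith

/-! Regime `1 ≤ s` -/

lemma succ_le_two_pow (k : ℕ) : (k : ℝ) + 1 ≤ 2 ^ k := by
  have : k + 1 ≤ 2 ^ k := Nat.lt_two_pow_self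
  exact_mod_cast this

lemma boundA {s : ℝ} (k : ℕ) (j : ℕ) (hj : j ≤ 2) (hs : 0 < s) :
    aA k ^ j * Real.exp (-(aA k) * s) ≤
      Real.pi ^ j * Real.exp (-Real.pi * s) * (16 * Real.exp (-Real.pi * s) ^ 3) ^ k := by
  have hk : (k : ℝ) ≤ (k : ℝ) ^ 2 := by
    exact_mod_cast Nat.le_self_pow two_ne_zero k
  have hpi := Real.pi_pos
  have e1 : Real.exp (-(aA k) * s) ≤ Real.exp (-Real.pi * s) * (Real.exp (-Real.pi * s) ^ 3) ^ k := by
    rw [← pow_mul, ← Real.exp_nat_mul, ← Real.exp_add]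
    apply Real.exp_le_exp.2
    unfold aA; push_cast
    nlinarith [mul_nonneg (mul_pos hpi hs).le (sub_nonneg.2 hk)]
  have e2 : aA k ^ j ≤ Real.pi ^ j * 16 ^ k := by
    unfold aA
    rw [mul_pow]
    gcongr
    rw [← pow_mul]
    have h0 : (1 : ℝ) ≤ (k : ℝ) + 1 := by linarith [(Nat.cast_nonneg k : (0 : ℝ) ≤ k)]
    calc ((k : ℝ) + 1) ^ (2 * j) ≤ ((k : ℝ) + 1) ^ 4 := pow_le_pow_right₀ h0 (by omega)
      _ ≤ (2 ^ k) ^ 4 := by gcongr; exact succ_le_two_pow k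
      _ = 16 ^ k := by rw [← pow_mul, mul_comm, pow_mul]; norm_num
  calc _ ≤ (Real.pi ^ j * 16 ^ k) * (Real.exp (-Real.pi * s) * (Real.exp (-Real.pi * s) ^ 3) ^ k) := by
        gcongr
    _ = _ := by rw [mul_pow 16]; ring

lemma estA {s : ℝ} (hs : 1 ≤ s) {c : ℕ → ℝ} (j : ℕ) (hj : j ≤ 2) (hc : ∀ k, |c k| = aA k ^ j) :
    |expSer c aA s - c 0 * Real.exp (-Real.pi * s)| ≤
      Real.pi ^ j * Real.exp (-Real.pi * s) * (1 / 100) := by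
  have hq : Real.exp (-Real.pi * s) ≤ 1 / 20 := by
    have h3 : Real.exp (-Real.pi * s) ≤ Real.exp (-3) :=
      Real.exp_le_exp.2 (by nlinarith [Real.pi_gt_three])
    refine h3.trans ?_
    rw [Real.exp_neg, ← one_div]
    apply one_div_le_one_div_of_le (by norm_num)
    have := Real.exp_one_gt_d9
    rw [show (3 : ℝ) = ((3 : ℕ) : ℝ) * 1 by norm_num, Real.exp_nat_mul]
    calc (20 : ℝ) ≤ 2.7182818283 ^ 3 := by norm_num
      _ ≤ _ := by gcongr
  have hq0 := Real.exp_pos (-Real.pi * s)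
  have hq3 : Real.exp (-Real.pi * s) ^ 3 ≤ (1 / 20) ^ 3 := by gcongr
  have := tail_bound (f := fun k => c k * Real.exp (-(aA k) * s))
    (B := Real.pi ^ j * Real.exp (-Real.pi * s)) (r := 16 * Real.exp (-Real.pi * s) ^ 3)
    (by positivity) (by positivity) (by nlinarith) (fun k => by
      rw [abs_mul, hc k, abs_of_pos (Real.exp_pos _)]
      exact boundA k j hj (by linarith))
  have e0 : aA 0 = Real.pi := by simp [aA]
  rw [e0] at this
  refine this.trans ?_
  gcongr
  nlinarith

lemma caseA (s : ℝ) (hs : 1 ≤ s) :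
    deriv (deriv theta4) s * theta4 s - (deriv theta4 s) ^ 2 <
      -(deriv theta4 s * theta4 s) / s ∧
    -(deriv theta4 s * theta4 s) / s < 0 := by
  have hs0 : 0 < s := by linarith
  set c1 : ℕ → ℝ := fun k => -(aA k) * cA k with hc1
  set c2 : ℕ → ℝ := fun k => -(aA k) * c1 k with hc2
  have ev : ∀ z : ℝ, 0 < z → theta4 =ᶠ[nhds z] fun z => 1 + 2 * expSer cA aA z := fun z hz => by
    filter_upwards [lt_mem_nhds hz] with y hy using theta4_A hy
  have d1 : ∀ z : ℝ, 0 < z → deriv theta4 z = 2 * expSer c1 aA z := fun z hz => by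
    rw [(ev z hz).deriv_eq]
    exact (((okA.hasDerivAt hz).const_mul 2).const_add 1).deriv
  have d2 : deriv (deriv theta4) s = 2 * expSer c2 aA s := by
    have : deriv theta4 =ᶠ[nhds s] fun z => 2 * expSer c1 aA z := by
      filter_upwards [lt_mem_nhds hs0] with y hy using d1 y hy
    rw [this.deriv_eq]
    exact ((okA.der.hasDerivAt hs0).const_mul 2).deriv
  rw [d2, d1 s hs0, theta4_A hs0]
  have hpos : ∀ k, 0 ≤ aA k := okA.1
  have e0 : aA 0 = Real.pi := by simp [aA]
  have A0 := estA hs (c := cA) 0 (by norm_num) (fun k => by simp [cA])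
  have A1 := estA hs (c := c1) 1 (by norm_num) (fun k => by
    simp [hc1, cA, abs_mul, abs_of_nonneg (hpos k)])
  have A2 := estA hs (c := c2) 2 (by norm_num) (fun k => by
    simp [hc2, hc1, cA, abs_mul, abs_of_nonneg (hpos k), sq])
  have z0 : cA 0 = -1 := by simp [cA]
  have z1 : c1 0 = Real.pi := by simp [hc1, z0, e0]
  have z2 : c2 0 = -Real.pi ^ 2 := by simp only [hc2, z1, e0]; ring
  rw [z0] at A0
  rw [z1] at A1
  rw [z2] at A2
  have hq0 := Real.exp_pos (-Real.pi * s)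
  have hq : Real.exp (-Real.pi * s) ≤ 1 / 4 := by
    have h3 := Real.add_one_le_exp (Real.pi * s)
    rw [neg_mul, Real.exp_neg, ← one_div]
    apply one_div_le_one_div_of_le (by norm_num)
    nlinarith [Real.pi_gt_three]
  set q := Real.exp (-Real.pi * s)
  set F0 := expSer cA aA s
  set F1 := expSer c1 aA s
  set F2 := expSer c2 aA s
  have hpi := Real.pi_gt_three
  have hpq : 0 < Real.pi * q := by positivity
  rw [abs_le] at A0 A1 A2
  have hth : 0 < 1 + 2 * F0 := by linarith [A0.1]
  have hF1 : 0 < F1 := by linarith [A1.1]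
  have hF2 : s * F2 + F1 < 0 := by
    have h1 : F2 ≤ -(99 / 100) * (Real.pi * (Real.pi * q)) := by linarith [A2.2]
    have h2 : F1 ≤ (101 / 100) * (Real.pi * q) := by linarith [A1.2]
    have h3 : 3 * (Real.pi * q) ≤ Real.pi * (Real.pi * q) := by gcongr
    nlinarith
  have hp : 0 < 2 * F1 * (1 + 2 * F0) := by positivity
  constructor
  · rw [lt_div_iff₀ hs0]
    nlinarith [mul_neg_of_pos_of_neg hth hF2, mul_pos hs0 (sq_pos_of_pos hF1)]
  · exact div_neg_of_neg_of_pos (by linarith) hs0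

/-! Regime `s ≤ 1` -/

lemma boundB {t : ℝ} (k : ℕ) (ht : 0 < t) :
    aB k ^ 2 * Real.exp (-(aB k) * t) ≤
      4 * Real.pi ^ 2 * Real.exp (-2 * Real.pi * t) * (16 * Real.exp (-2 * Real.pi * t) ^ 2) ^ k := by
  have hk : (k : ℝ) ≤ (k : ℝ) ^ 2 := by
    exact_mod_cast Nat.le_self_pow two_ne_zero k
  have hpi := Real.pi_pos
  have e1 : Real.exp (-(aB k) * t) ≤
      Real.exp (-2 * Real.pi * t) * (Real.exp (-2 * Real.pi * t) ^ 2) ^ k := by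
    rw [← pow_mul, ← Real.exp_nat_mul, ← Real.exp_add]
    apply Real.exp_le_exp.2
    unfold aB; push_cast
    nlinarith [mul_nonneg (mul_pos hpi ht).le (sub_nonneg.2 hk)]
  have e2 : aB k ^ 2 ≤ 4 * Real.pi ^ 2 * 16 ^ k := by
    have h1 := succ_le_two_pow k
    have h2 : (k : ℝ) + 2 ≤ 2 * 2 ^ k := by linarith [one_le_pow₀ (M₀ := ℝ) (a := 2) (by norm_num) (n := k)]
    calc aB k ^ 2 ≤ (Real.pi * (2 ^ k * (2 * 2 ^ k))) ^ 2 := by unfold aB; gcongr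
      _ = 4 * Real.pi ^ 2 * (2 ^ k) ^ 4 := by ring
      _ = _ := by rw [← pow_mul, mul_comm k 4, pow_mul]; norm_num
  calc _ ≤ (4 * Real.pi ^ 2 * 16 ^ k) *
        (Real.exp (-2 * Real.pi * t) * (Real.exp (-2 * Real.pi * t) ^ 2) ^ k) := by gcongr
    _ = _ := by rw [mul_pow 16]; ring

lemma estB {t : ℝ} (ht : 1 ≤ t) {c : ℕ → ℝ} (hc : ∀ k, c k = aB k ^ 2) :
    t * expSer c aB t < Real.pi / 4 := by
  have ht0 : 0 < t := by linarith
  have hpi := Real.pi_gt_three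
  have hpi2 := Real.pi_lt_d2
  have hqt : 300 * t * Real.exp (-2 * Real.pi * t) ≤ 1 := by
    have h3 : Real.exp (-2 * Real.pi * t) ≤ Real.exp (-(6 * t)) :=
      Real.exp_le_exp.2 (by nlinarith [Real.pi_gt_three])
    have h4 : 300 * t ≤ Real.exp (6 * t) := by
      have h5 : t * Real.exp 1 ≤ Real.exp t := by
        have := Real.add_one_le_exp (t - 1)
        have e : Real.exp t = Real.exp (t - 1) * Real.exp 1 := by rw [← Real.exp_add]; congr 1; ring
        rw [e]; gcongr; linarith
      have h6 : 2.7 * t ≤ Real.exp t := by nlinarith [Real.exp_one_gt_d9]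
      rw [show 6 * t = ((6 : ℕ) : ℝ) * t by norm_num, Real.exp_nat_mul]
      calc 300 * t ≤ 2.7 ^ 6 * (t * 1) := by norm_num; nlinarith
        _ ≤ 2.7 ^ 6 * (t * t ^ 5) := by gcongr; exact one_le_pow₀ ht
        _ = (2.7 * t) ^ 6 := by ring
        _ ≤ _ := by gcongr
    calc 300 * t * Real.exp (-2 * Real.pi * t) ≤ Real.exp (6 * t) * Real.exp (-(6 * t)) := by gcongr
      _ = 1 := by rw [← Real.exp_add]; simp
  have hq0 := Real.exp_pos (-2 * Real.pi * t)
  have hq : Real.exp (-2 * Real.pi * t) ≤ 1 / 300 := by nlinarith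
  have hq3 : Real.exp (-2 * Real.pi * t) ^ 2 ≤ (1 / 300) ^ 2 := by gcongr
  have := tail_bound (f := fun k => c k * Real.exp (-(aB k) * t))
    (B := 4 * Real.pi ^ 2 * Real.exp (-2 * Real.pi * t)) (r := 16 * Real.exp (-2 * Real.pi * t) ^ 2)
    (by positivity) (by positivity) (by nlinarith) (fun k => by
      rw [abs_mul, hc k, abs_of_pos (Real.exp_pos _), abs_of_nonneg (sq_nonneg _)]
      exact boundB k ht0)
  have e0 : aB 0 = 2 * Real.pi := by simp [aB]; ring
  simp only [hc 0, e0] at this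
  rw [show -(2 * Real.pi) * t = -2 * Real.pi * t by ring] at this
  have h7 := (abs_le.1 this).2
  set q := Real.exp (-2 * Real.pi * t)
  have hpq : 0 < Real.pi ^ 2 * q := by positivity
  have h8 : expSer c aB t ≤ 4.1 * (Real.pi ^ 2 * q) := by
    have : 4 * Real.pi ^ 2 * q * (2 * (16 * q ^ 2)) ≤ 4 * Real.pi ^ 2 * q * (1 / 40) := by
      gcongr; nlinarith
    unfold expSer; linarith
  have h9 : Real.pi ^ 2 ≤ 10 := by nlinarith
  calc t * expSer c aB t ≤ t * (4.1 * (Real.pi ^ 2 * q)) := by gcongr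
    _ = 4.1 / 300 * Real.pi ^ 2 * (300 * t * q) := by ring
    _ ≤ 4.1 / 300 * 10 * 1 := by gcongr
    _ < Real.pi / 4 := by linarith

lemma caseB (s : ℝ) (hs0 : 0 < s) (hs : s ≤ 1) :
    deriv (deriv theta4) s * theta4 s - (deriv theta4 s) ^ 2 <
      -(deriv theta4 s * theta4 s) / s ∧
    -(deriv theta4 s * theta4 s) / s < 0 := by
  set c1 : ℕ → ℝ := fun k => -(aB k) * 1 with hc1
  set c2 : ℕ → ℝ := fun k => -(aB k) * c1 k with hc2
  set G0 := expSer (fun _ => 1) aB with hG0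
  set G1 := expSer c1 aB with hG1
  set G2 := expSer c2 aB with hG2
  have hpos : ∀ z, 0 < 1 + G0 z := fun z => by
    have : 0 ≤ G0 z := tsum_nonneg fun k => by positivity
    linarith
  have hG1n : ∀ z, G1 z ≤ 0 := fun z => tsum_nonpos fun k => by
    have := okB.1 k
    have := mul_nonneg this (Real.exp_pos (-(aB k) * z)).le
    simp only [hc1]; linarith
  have hG2p : ∀ z, 0 ≤ G2 z := fun z => tsum_nonneg fun k => by
    have := okB.1 k
    simp only [hc2, hc1, mul_one, neg_mul_neg]; positivity
  have D0 : ∀ z, 0 < z → HasDerivAt G0 (G1 z) z := fun z hz => okB.hasDerivAt hz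
  have D1 : ∀ z, 0 < z → HasDerivAt G1 (G2 z) z := fun z hz => okB.der.hasDerivAt hz
  set L : ℝ → ℝ := fun z => -(1 / 2) * z⁻¹ + Real.pi / 4 * (z⁻¹ ^ 2) -
    (G1 z⁻¹ / (1 + G0 z⁻¹)) * (z⁻¹ ^ 2) with hL
  have d1 : ∀ z : ℝ, 0 < z → HasDerivAt theta4 (theta4 z * L z) z := fun z hz => by
    have ev : theta4 =ᶠ[nhds z] fun s => 2 * s ^ (-(1 / 2) : ℝ) *
        Real.exp (-(Real.pi / 4) * s⁻¹) * (1 + G0 s⁻¹) := by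
      filter_upwards [lt_mem_nhds hz] with y hy using theta4_B hy
    refine HasDerivAt.congr_of_eventuallyEq ?_ ev
    have hi := hasDerivAt_inv hz.ne'
    have k1 := (Real.hasDerivAt_rpow_const (x := z) (p := -(1 / 2)) (Or.inl hz.ne')).const_mul 2
    have k2 := (hi.const_mul (-(Real.pi / 4))).exp
    have k3 := ((D0 z⁻¹ (inv_pos.2 hz)).comp z hi).const_add 1
    have k := (k1.mul k2).mul k3
    refine k.congr_deriv ?_
    rw [theta4_B hz, Real.rpow_sub_one hz.ne']
    simp only [hL, Function.comp, Pi.mul_apply, ← hG0]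
    have := (hpos z⁻¹).ne'
    clear k k1 k2 k3
    generalize Real.exp (-(Real.pi / 4) * z⁻¹) = e
    generalize z ^ (-(1 / 2) : ℝ) = w
    generalize G1 z⁻¹ = x1
    generalize 1 + G0 z⁻¹ = x0 at *
    field_simp
    ring
  have hi := hasDerivAt_inv hs0.ne'
  have hti : 0 < s⁻¹ := inv_pos.2 hs0
  have d2 : HasDerivAt L (-(1 / 2) * (-(s ^ 2)⁻¹) + Real.pi / 4 * (2 * s⁻¹ * (-(s ^ 2)⁻¹)) -
      ((G2 s⁻¹ * (-(s ^ 2)⁻¹) * (1 + G0 s⁻¹) - G1 s⁻¹ * (G1 s⁻¹ * (-(s ^ 2)⁻¹))) / (1 + G0 s⁻¹) ^ 2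
        * (s⁻¹ ^ 2) + (G1 s⁻¹ / (1 + G0 s⁻¹)) * (2 * s⁻¹ * (-(s ^ 2)⁻¹)))) s := by
    have hsq : HasDerivAt (fun z : ℝ => z⁻¹ ^ 2) (2 * s⁻¹ * (-(s ^ 2)⁻¹)) s := by
      have := hi.pow 2
      refine (this.congr_deriv ?_)
      simp
    have g0 := ((D0 s⁻¹ hti).comp s hi).const_add 1
    have g1 := (D1 s⁻¹ hti).comp s hi
    exact ((hi.const_mul (-(1 / 2))).add (hsq.const_mul (Real.pi / 4))).sub
      ((g1.div g0 (hpos s⁻¹).ne').mul hsq)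
  set L' := (-(1 / 2) * (-(s ^ 2)⁻¹) + Real.pi / 4 * (2 * s⁻¹ * (-(s ^ 2)⁻¹)) -
      ((G2 s⁻¹ * (-(s ^ 2)⁻¹) * (1 + G0 s⁻¹) - G1 s⁻¹ * (G1 s⁻¹ * (-(s ^ 2)⁻¹))) / (1 + G0 s⁻¹) ^ 2
        * (s⁻¹ ^ 2) + (G1 s⁻¹ / (1 + G0 s⁻¹)) * (2 * s⁻¹ * (-(s ^ 2)⁻¹)))) with hL'
  have dd : deriv (deriv theta4) s = theta4 s * L s * L s + theta4 s * L' := by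
    have : deriv theta4 =ᶠ[nhds s] fun z => theta4 z * L z := by
      filter_upwards [lt_mem_nhds hs0] with y hy using (d1 y hy).deriv
    rw [this.deriv_eq]
    exact ((d1 s hs0).mul d2).deriv
  rw [dd, (d1 s hs0).deriv]
  have hth : 0 < theta4 s := by
    rw [theta4_B hs0]
    have := hpos s⁻¹
    have := Real.rpow_pos_of_pos hs0 (-(1 / 2) : ℝ)
    positivity
  have ht : 1 ≤ s⁻¹ := (one_le_inv₀ hs0).2 hs
  have hest : s⁻¹ * G2 s⁻¹ < Real.pi / 4 := estB ht (fun k => by simp only [hc2, hc1]; ring)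
  have hpi := Real.pi_gt_three
  have hst : s * s⁻¹ = 1 := mul_inv_cancel₀ hs0.ne'
  have hG0p : 0 ≤ G0 s⁻¹ := tsum_nonneg fun k => by positivity
  have hM : G1 s⁻¹ / (1 + G0 s⁻¹) ≤ 0 := div_nonpos_of_nonpos_of_nonneg (hG1n _) (hpos _).le
  have hN : G2 s⁻¹ / (1 + G0 s⁻¹) ≤ G2 s⁻¹ := div_le_self (hG2p _) (by linarith)
  have hLpos : 0 < L s := by
    simp only [hL]
    have h1 : 0 ≤ -(G1 s⁻¹ / (1 + G0 s⁻¹)) * s⁻¹ ^ 2 := mul_nonneg (by linarith) (by positivity)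
    nlinarith
  have key : L' + L s / s < 0 := by
    have e : L' + L s / s = s⁻¹ ^ 3 * (-(Real.pi / 4) + G1 s⁻¹ / (1 + G0 s⁻¹) +
        s⁻¹ * (G2 s⁻¹ / (1 + G0 s⁻¹)) - s⁻¹ * (G1 s⁻¹ / (1 + G0 s⁻¹)) ^ 2) := by
      simp only [hL', hL]
      have := (hpos s⁻¹).ne'
      clear hL' d2 dd
      clear_value L'
      generalize G2 s⁻¹ = x2
      generalize G1 s⁻¹ = x1
      generalize 1 + G0 s⁻¹ = x0 at *
      field_simp
      ring
    rw [e]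
    refine mul_neg_of_pos_of_neg (by positivity) ?_
    have h1 : 0 ≤ s⁻¹ * (G1 s⁻¹ / (1 + G0 s⁻¹)) ^ 2 := by positivity
    have h2 := mul_le_mul_of_nonneg_left hN hti.le
    linarith
  constructor
  · have h1 := mul_neg_of_pos_of_neg (mul_pos hth hth) key
    have h2 : -(theta4 s * L s * theta4 s) / s = -(theta4 s * theta4 s * (L s / s)) := by ring
    rw [h2]; nlinarith
  · exact div_neg_of_neg_of_pos (by have := mul_pos (mul_pos hth hLpos) hth; linarith) hs0

theorem theta4_refined_log_concave (s : ℝ) (hs : 0 < s) :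
    deriv (deriv theta4) s * theta4 s - (deriv theta4 s) ^ 2 <
      -(deriv theta4 s * theta4 s) / s ∧
    -(deriv theta4 s * theta4 s) / s < 0 := by
  rcases le_total 1 s with h | h
  · exact caseA s h
  · exact caseB s hs h
end

section
/- The function s ↦ s · θ₃'(s)/θ₃(s) is strictly increasing on the positive real half-line (0, ∞). -/
noncomputable def auxS (s : ℝ) : ℝ :=
  ∑' k : ℤ, (k : ℝ) ^ 2 * Real.exp (-Real.pi * (k : ℝ) ^ 2 * s)

lemma aux_sum0 {s : ℝ} (hs : 0 < s) :
    Summable (fun k : ℤ => Real.exp (-Real.pi * (k : ℝ) ^ 2 * s)) := by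
  refine (summable_pow_mul_jacobiTheta₂_term_bound 0 hs 0).congr fun k => ?_
  rw [pow_zero, one_mul]; congr 1; ring

lemma aux_sum2 {s : ℝ} (hs : 0 < s) :
    Summable (fun k : ℤ => (k : ℝ) ^ 2 * Real.exp (-Real.pi * (k : ℝ) ^ 2 * s)) := by
  refine (summable_pow_mul_jacobiTheta₂_term_bound 0 hs 2).congr fun k => ?_
  push_cast
  rw [sq_abs]; congr 2; ring

lemma aux_one_le {s : ℝ} (hs : 0 < s) : 1 ≤ theta3 s := by
  have := (aux_sum0 hs).le_tsum 0 (fun _ _ => (Real.exp_pos _).le)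
  simpa [theta3] using this

lemma aux_S_pos {s : ℝ} (hs : 0 < s) : 0 < auxS s := by
  have := (aux_sum2 hs).le_tsum 1 (fun _ _ => by positivity)
  refine lt_of_lt_of_le ?_ this
  simp [Real.exp_pos]

lemma aux_deriv {s : ℝ} (hs : 0 < s) : HasDerivAt theta3 (-Real.pi * auxS s) s := by
  have h2 : 0 < s / 2 := by linarith
  have hu : Summable (fun k : ℤ => Real.pi * ((k : ℝ) ^ 2 * Real.exp (-Real.pi * (k : ℝ) ^ 2 * (s/2)))) :=
    (aux_sum2 h2).mul_left _
  have := hasDerivAt_tsum_of_isPreconnected (t := Set.Ioi (s / 2))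
    (g := fun (k : ℤ) (y : ℝ) => Real.exp (-Real.pi * (k : ℝ) ^ 2 * y))
    (g' := fun (k : ℤ) (y : ℝ) => -Real.pi * ((k : ℝ) ^ 2 * Real.exp (-Real.pi * (k : ℝ) ^ 2 * y)))
    hu isOpen_Ioi isPreconnected_Ioi
    (fun k y _ => by
      have := ((hasDerivAt_id y).const_mul (-Real.pi * (k : ℝ) ^ 2)).exp
      refine this.congr_deriv ?_
      simp only [id]; ring)
    (fun k y hy => by
      have hy' : s / 2 < y := hy
      rw [norm_mul, norm_neg, Real.norm_of_nonneg Real.pi_pos.le, Real.norm_of_nonneg (by positivity)]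
      gcongr ?_ * (_ * Real.exp ?_)
      have : 0 ≤ Real.pi * (k : ℝ) ^ 2 := by positivity
      nlinarith)
    (y₀ := s) (by simp; linarith) (aux_sum0 hs) (y := s) (by simp; linarith)
  rw [tsum_mul_left] at this
  exact this

lemma aux_S_le {s : ℝ} (hs : 1 ≤ s) : auxS s ≤ 1 / 2 := by
  have hpi := Real.pi_gt_three
  have e1 : Real.exp (-1) ≤ 0.368 := by
    have := Real.exp_neg_one_lt_d9; linarith
  have e2 : Real.exp (-2) ≤ 7 / 50 := by
    have : Real.exp (-2) = Real.exp (-1) * Real.exp (-1) := by rw [← Real.exp_add]; norm_num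
    rw [this]; nlinarith [Real.exp_pos (-1)]
  have key : ∀ (k : ℤ) (n : ℕ), (n : ℝ) ≤ (k : ℝ) ^ 2 →
      (k : ℝ) ^ 2 * Real.exp (-Real.pi * (k : ℝ) ^ 2 * s) ≤ 0.368 * (7 / 50) ^ n := by
    intro k n hn
    have hk : 0 ≤ (k : ℝ) ^ 2 := by positivity
    have h1 : (k : ℝ) ^ 2 ≤ Real.exp ((k : ℝ) ^ 2 - 1) := by
      have := Real.add_one_le_exp ((k : ℝ) ^ 2 - 1); linarith
    have h3 : 3 ≤ Real.pi * s := by nlinarith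
    calc (k : ℝ) ^ 2 * Real.exp (-Real.pi * (k : ℝ) ^ 2 * s)
        ≤ Real.exp ((k : ℝ) ^ 2 - 1) * Real.exp (-Real.pi * (k : ℝ) ^ 2 * s) := by gcongr
      _ = Real.exp ((k : ℝ) ^ 2 - 1 - (Real.pi * s) * (k : ℝ) ^ 2) := by
          rw [← Real.exp_add]; congr 1; ring
      _ ≤ Real.exp (-1 + n * (-2)) := by
          apply Real.exp_le_exp.2; nlinarith
      _ = Real.exp (-1) * Real.exp (-2) ^ n := by rw [Real.exp_add, Real.exp_nat_mul]
      _ ≤ _ := by gcongr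
  have hsm := aux_sum2 (show 0 < s by linarith)
  have i1 : Function.Injective (fun n : ℕ => (n : ℤ)) := Nat.cast_injective
  have i2 : Function.Injective (fun n : ℕ => -((n : ℤ) + 1)) := fun a b h => by
    simp at h; exact h
  unfold auxS
  set F : ℤ → ℝ := fun k => (k : ℝ) ^ 2 * Real.exp (-Real.pi * (k : ℝ) ^ 2 * s) with hF
  have s1 : Summable (fun n : ℕ => F n) := hsm.comp_injective i1
  have s2 : Summable (fun n : ℕ => F (-((n : ℤ) + 1))) := hsm.comp_injective i2
  have hg := hasSum_geometric_of_lt_one (r := (7 / 50 : ℝ)) (by norm_num) (by norm_num)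
  have k1 : ∀ n : ℕ, F n ≤ 0.368 * (7 / 50) ^ n := fun n => key n n (by
    exact_mod_cast Nat.le_self_pow two_ne_zero n)
  have k2 : ∀ n : ℕ, F (-((n : ℤ) + 1)) ≤ (0.368 * (7 / 50)) * (7 / 50) ^ n := fun n => by
    have := key (-((n : ℤ) + 1)) (n + 1) (by
      push_cast; nlinarith [(Nat.cast_nonneg n : (0:ℝ) ≤ n)])
    refine this.trans_eq ?_
    ring
  have b1 := hasSum_le k1 s1.hasSum (hg.mul_left _)
  have b2 := hasSum_le k2 s2.hasSum (hg.mul_left _)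
  have ht := (s1.hasSum.of_nat_of_neg_add_one s2.hasSum).tsum_eq
  rw [ht]
  refine (add_le_add b1 b2).trans ?_
  norm_num

lemma aux_fe {s : ℝ} (hs : 0 < s) : theta3 s = s ^ (-(1 / 2) : ℝ) * theta3 s⁻¹ := by
  have := Real.tsum_exp_neg_mul_int_sq hs
  rw [Real.rpow_neg hs.le, ← one_div]
  unfold theta3
  rw [show (fun k : ℤ => Real.exp (-Real.pi * (k : ℝ) ^ 2 * s))
      = fun k : ℤ => Real.exp (-Real.pi * s * (k : ℝ) ^ 2) from
        funext fun k => congrArg Real.exp (by ring), this]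
  congr 2
  exact funext fun k => congrArg Real.exp (by ring)

lemma aux_refl {s : ℝ} (hs : 0 < s) :
    s * deriv theta3 s / theta3 s
      = -(1 / 2) - s⁻¹ * deriv theta3 s⁻¹ / theta3 s⁻¹ := by
  have hi : 0 < s⁻¹ := inv_pos.2 hs
  have h1 : HasDerivAt (fun t : ℝ => t ^ (-(1 / 2) : ℝ) * theta3 t⁻¹)
      (_) s := (Real.hasDerivAt_rpow_const (p := (-(1/2) : ℝ)) (Or.inl hs.ne')).mul
        ((aux_deriv hi).comp s (hasDerivAt_inv hs.ne'))
  have h2 := h1.congr_of_eventuallyEq (f₁ := theta3)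
    (by filter_upwards [lt_mem_nhds hs] with t ht using aux_fe ht)
  rw [h2.deriv, aux_fe hs, (aux_deriv hi).deriv, Real.rpow_sub_one hs.ne']
  have p1 := Real.rpow_pos_of_pos hs (-(1 / 2))
  have p2 := aux_one_le hi
  have p3 : theta3 s⁻¹ ≠ 0 := by linarith
  generalize theta3 s⁻¹ = T at *
  generalize auxS s⁻¹ = A at *
  generalize s ^ (-(1 / 2) : ℝ) = P at *
  field_simp
  ring

lemma aux_mono : StrictMonoOn (fun s : ℝ => s * deriv theta3 s / theta3 s) (Set.Ici 1) := by
  intro x hx y hy hxy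
  simp only [Set.mem_Ici] at hx hy
  have hx0 : 0 < x := by linarith
  have hy0 : 0 < y := by linarith
  have hpi := Real.pi_gt_three
  have hSx := aux_S_pos hx0
  have hDx := aux_one_le hx0
  have hDy := aux_one_le hy0
  simp only [(aux_deriv hx0).deriv, (aux_deriv hy0).deriv]
  rw [div_lt_div_iff₀ (by linarith) (by linarith)]
  set d := Real.pi * (y - x) with hd
  have hd0 : 0 < d := by apply mul_pos <;> linarith
  set E := Real.exp (-(d / 2)) with hE
  have hE0 : 0 < E := Real.exp_pos _
  have hE1 : (1 + d / 2) * E ≤ 1 := by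
    have h := Real.add_one_le_exp (d / 2)
    have : Real.exp (d / 2) * E = 1 := by rw [hE, ← Real.exp_add]; simp
    nlinarith
  -- S y ≤ E² S x
  have hS : auxS y ≤ E * E * auxS x := by
    unfold auxS
    rw [← tsum_mul_left]
    refine (aux_sum2 hy0).tsum_le_tsum (fun k => ?_) ((aux_sum2 hx0).mul_left _)
    rcases eq_or_ne k 0 with rfl | hk
    · simp
    have hk1 : (1 : ℝ) ≤ (k : ℝ) ^ 2 := by
      have : (1 : ℤ) ≤ k ^ 2 := by have := sq_pos_of_ne_zero hk; omega
      exact_mod_cast this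
    rw [mul_left_comm, hE, ← Real.exp_add, ← Real.exp_add]
    gcongr
    nlinarith
  have hyx : y * E < x := by
    have : y < x * (1 + d / 2) := by nlinarith
    nlinarith
  have hD : theta3 x * E ≤ theta3 y := by
    have h1 : theta3 x ≤ theta3 y + d * auxS x := by
      unfold theta3 auxS
      rw [← tsum_mul_left, ← (aux_sum0 hy0).tsum_add ((aux_sum2 hx0).mul_left _)]
      refine (aux_sum0 hx0).tsum_le_tsum (fun k => ?_)
        ((aux_sum0 hy0).add ((aux_sum2 hx0).mul_left _))
      have h := Real.add_one_le_exp (-(d * (k : ℝ) ^ 2))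
      have h' : Real.exp (-Real.pi * (k : ℝ) ^ 2 * y)
          = Real.exp (-Real.pi * (k : ℝ) ^ 2 * x) * Real.exp (-(d * (k : ℝ) ^ 2)) := by
        rw [← Real.exp_add]; congr 1; rw [hd]; ring
      rw [h']
      nlinarith [Real.exp_pos (-Real.pi * (k : ℝ) ^ 2 * x)]
    have h2 : auxS x ≤ 1 / 2 := aux_S_le hx
    have h3 : theta3 x ≤ theta3 y * (1 + d / 2) := by nlinarith
    calc theta3 x * E ≤ theta3 y * (1 + d / 2) * E := by gcongr
      _ = theta3 y * ((1 + d / 2) * E) := by ring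
      _ ≤ theta3 y * 1 := by gcongr
      _ = _ := mul_one _
  have main : y * auxS y * theta3 x < x * auxS x * theta3 y := by
    calc y * auxS y * theta3 x ≤ y * (E * E * auxS x) * theta3 x := by gcongr
      _ = (y * E) * auxS x * (theta3 x * E) := by ring
      _ ≤ (y * E) * auxS x * theta3 y := by gcongr
      _ < x * auxS x * theta3 y := by gcongr
  nlinarith

theorem theta3_log_deriv_strictMono :
    StrictMonoOn (fun s : ℝ => s * deriv theta3 s / theta3 s) (Set.Ioi 0) := by
  have h1 : StrictMonoOn (fun s : ℝ => s * deriv theta3 s / theta3 s) (Set.Ioc 0 1) := by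
    intro x hx y hy hxy
    have := aux_mono (a := y⁻¹) (b := x⁻¹) ((one_le_inv₀ hy.1).2 hy.2)
      ((one_le_inv₀ hx.1).2 hx.2) ((inv_lt_inv₀ hy.1 hx.1).2 hxy)
    simp only at this ⊢
    rw [aux_refl hx.1, aux_refl hy.1]
    linarith
  have := h1.union aux_mono (c := 1) ⟨by simp, fun a ha => ha.2⟩ ⟨by simp, fun a ha => ha⟩
  rwa [Set.Ioc_union_Ici_eq_Ioi (by norm_num)] at this
end

section
/- For every s ≥ 0.7, one has s·θ₃''(s) + θ₃'(s)·θ₃(s) − s·θ₃'(s)² > 0. -/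
noncomputable def thTerm (j n : ℕ) (s : ℝ) : ℝ :=
  (((n : ℝ) + 1) ^ 2) ^ j * Real.exp (-Real.pi * ((n : ℝ) + 1) ^ 2 * s)

lemma thTerm_nonneg (j n : ℕ) (s : ℝ) : 0 ≤ thTerm j n s := by
  unfold thTerm; positivity

lemma thTerm_anti (j n : ℕ) {c s : ℝ} (h : c ≤ s) : thTerm j n s ≤ thTerm j n c := by
  unfold thTerm
  have : -Real.pi * ((n : ℝ) + 1) ^ 2 * s ≤ -Real.pi * ((n : ℝ) + 1) ^ 2 * c := by
    have : 0 ≤ Real.pi * ((n : ℝ) + 1) ^ 2 := by positivity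
    nlinarith
  gcongr

lemma thTerm_summable (j : ℕ) {s : ℝ} (hs : 0 < s) : Summable (fun n => thTerm j n s) := by
  have hr : ‖Real.exp (-Real.pi * s)‖ < 1 := by
    rw [Real.norm_eq_abs, abs_of_pos (Real.exp_pos _), Real.exp_lt_one_iff]
    nlinarith [mul_pos Real.pi_pos hs]
  have h := summable_pow_mul_geometric_of_norm_lt_one (R := ℝ) (2 * j) hr
  have h' := (summable_nat_add_iff 1).2 h
  refine Summable.of_nonneg_of_le (fun n => thTerm_nonneg j n s) (fun n => ?_) h'
  unfold thTerm
  rw [← pow_mul, ← Real.exp_nat_mul]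
  push_cast
  gcongr ?_ * Real.exp ?_
  have h1 : 0 < Real.pi * s := mul_pos Real.pi_pos hs
  have h2 : (0 : ℝ) ≤ n := n.cast_nonneg
  have h3 : 0 ≤ (Real.pi * s) * (((n : ℝ) + 1) * n) := by positivity
  nlinarith

noncomputable def thT (j : ℕ) (s : ℝ) : ℝ := ∑' n, thTerm j n s

lemma thTerm_deriv (j n : ℕ) (s : ℝ) :
    HasDerivAt (thTerm j n) (-Real.pi * thTerm (j + 1) n s) s := by
  have h := (((hasDerivAt_id s).const_mul (-Real.pi * ((n : ℝ) + 1) ^ 2)).exp).const_mul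
    ((((n : ℝ) + 1) ^ 2) ^ j)
  refine HasDerivAt.congr_deriv h ?_
  simp only [thTerm, id]
  ring

lemma thT_deriv (j : ℕ) {s : ℝ} (hs : 0 < s) :
    HasDerivAt (thT j) (-Real.pi * thT (j + 1) s) s := by
  have hs2 : 0 < s / 2 := by linarith
  have h := hasDerivAt_tsum_of_isPreconnected (t := Set.Ioi (s / 2)) (y₀ := s) (y := s)
    (g := fun n => thTerm j n) (g' := fun n y => -Real.pi * thTerm (j + 1) n y)
    (u := fun n => Real.pi * thTerm (j + 1) n (s / 2))
    ((thTerm_summable (j + 1) hs2).mul_left _) isOpen_Ioi isPreconnected_Ioi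
    (fun n y _ => thTerm_deriv j n y)
    (fun n y hy => by
      rw [norm_mul, norm_neg, Real.norm_eq_abs, Real.norm_eq_abs, abs_of_pos Real.pi_pos,
        abs_of_nonneg (thTerm_nonneg _ _ _)]
      exact mul_le_mul_of_nonneg_left (thTerm_anti _ _ (le_of_lt hy)) Real.pi_pos.le)
    (by simp only [Set.mem_Ioi]; linarith) (thTerm_summable j hs)
    (by simp only [Set.mem_Ioi]; linarith)
  rw [tsum_mul_left] at h
  exact h

lemma theta3_eq_s7 {s : ℝ} (hs : 0 < s) : theta3 s = 1 + 2 * thT 0 s := by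
  have h : HasSum (fun n => thTerm 0 n s) (thT 0 s) := (thTerm_summable 0 hs).hasSum
  have h1 : HasSum (fun n : ℕ => Real.exp (-Real.pi * (((n : ℤ) + 1 : ℤ) : ℝ) ^ 2 * s))
      (thT 0 s) := by
    convert h using 2 with n
    simp [thTerm]
  have h2 : HasSum (fun n : ℕ => Real.exp (-Real.pi * ((-((n : ℤ) + 1) : ℤ) : ℝ) ^ 2 * s))
      (thT 0 s) := by
    convert h using 2 with n
    simp only [thTerm]
    push_cast
    rw [neg_sq]
    simp
  have h0 := HasSum.of_add_one_of_neg_add_one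
    (f := fun k : ℤ => Real.exp (-Real.pi * (k : ℝ) ^ 2 * s)) h1 h2
  unfold theta3
  rw [h0.tsum_eq]
  simp
  ring

lemma theta3_deriv {s : ℝ} (hs : 0 < s) : deriv theta3 s = -2 * Real.pi * thT 1 s := by
  have h : theta3 =ᶠ[nhds s] fun y => 1 + 2 * thT 0 y := by
    filter_upwards [lt_mem_nhds hs] with y hy using theta3_eq_s7 hy
  rw [h.deriv_eq, (((thT_deriv 0 hs).const_mul 2).const_add 1).deriv]
  ring

lemma theta3_deriv2 {s : ℝ} (hs : 0 < s) :
    deriv (deriv theta3) s = 2 * Real.pi ^ 2 * thT 2 s := by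
  have h : deriv theta3 =ᶠ[nhds s] fun y => -2 * Real.pi * thT 1 y := by
    filter_upwards [lt_mem_nhds hs] with y hy using theta3_deriv hy
  rw [h.deriv_eq, ((thT_deriv 1 hs).const_mul (-2 * Real.pi)).deriv]
  ring

lemma thT_mono (j : ℕ) {s : ℝ} (hs : 0 < s) : thT j s ≤ thT (j + 1) s := by
  refine (thTerm_summable j hs).tsum_le_tsum (fun n => ?_) (thTerm_summable (j + 1) hs)
  unfold thTerm
  have : (1 : ℝ) ≤ ((n : ℝ) + 1) ^ 2 := by
    have h2 : (0 : ℝ) ≤ n := n.cast_nonneg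
    nlinarith
  gcongr
  omega

lemma thT_pos (j : ℕ) {s : ℝ} (hs : 0 < s) : 0 < thT j s :=
  (thTerm_summable j hs).tsum_pos (fun n => thTerm_nonneg j n s) 0 (by unfold thTerm; positivity)

lemma exp_bound {x : ℝ} (hx : 2.19 ≤ x) : Real.exp (-x) ≤ 1 / 8 := by
  have h1 : Real.exp (-x) ≤ Real.exp (-(1 + 1 + 0.19)) := Real.exp_le_exp.2 (by linarith)
  refine h1.trans ?_
  rw [Real.exp_neg, ← one_div]
  apply one_div_le_one_div_of_le (by norm_num)
  rw [Real.exp_add, Real.exp_add]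
  have := Real.exp_one_gt_d9
  have h3 := Real.add_one_le_exp (0.19 : ℝ)
  have h4 : (7.38 : ℝ) ≤ Real.exp 1 * Real.exp 1 := by nlinarith
  nlinarith

lemma thT_one_le {s : ℝ} (hs : 0 < s) (hx : 2.19 ≤ Real.pi * s) : thT 1 s ≤ 1 / 7 := by
  have hg : HasSum (fun n : ℕ => (1 / 8 : ℝ) * (1 / 8) ^ n) (1 / 7) := by
    have := (hasSum_geometric_of_lt_one (r := (1 / 8 : ℝ)) (by norm_num) (by norm_num)).mul_left
      (1 / 8 : ℝ)
    have e : (1 / 8 : ℝ) * (1 - 1 / 8)⁻¹ = 1 / 7 := by norm_num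
    rw [e] at this
    exact this
  rw [← hg.tsum_eq]
  refine (thTerm_summable 1 hs).tsum_le_tsum (fun n => ?_) hg.summable
  unfold thTerm
  have e : Real.exp (-Real.pi * ((n : ℝ) + 1) ^ 2 * s) =
      Real.exp (-(Real.pi * s)) ^ ((n + 1) ^ 2) := by
    rw [← Real.exp_nat_mul]
    push_cast
    congr 1
    ring
  have h1 : Real.exp (-(Real.pi * s)) ^ ((n + 1) ^ 2) ≤ (1 / 8 : ℝ) ^ ((n + 1) ^ 2) :=
    pow_le_pow_left₀ (Real.exp_pos _).le (exp_bound hx) _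
  have h2 : ((n : ℝ) + 1) ^ 2 ≤ 8 ^ (n ^ 2 + n) := by
    have a : ((n + 1 : ℕ) : ℝ) ≤ 2 ^ n := by exact_mod_cast Nat.succ_le_of_lt Nat.lt_two_pow_self
    push_cast at a
    calc ((n : ℝ) + 1) ^ 2 ≤ (2 ^ n) ^ 2 := by gcongr
      _ = 4 ^ n := by rw [← pow_mul, mul_comm, pow_mul]; norm_num
      _ ≤ 8 ^ n := by gcongr; norm_num
      _ ≤ 8 ^ (n ^ 2 + n) := by
        apply pow_le_pow_right₀ (by norm_num)
        omega
  rw [e, pow_one]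
  calc ((n : ℝ) + 1) ^ 2 * Real.exp (-(Real.pi * s)) ^ ((n + 1) ^ 2)
      ≤ 8 ^ (n ^ 2 + n) * (1 / 8 : ℝ) ^ ((n + 1) ^ 2) := by gcongr
    _ = (8 * (1 / 8)) ^ (n ^ 2 + n) * ((1 / 8) * (1 / 8 : ℝ) ^ n) := by
      rw [mul_pow]; ring
    _ = (1 / 8) * (1 / 8 : ℝ) ^ n := by norm_num

theorem theta3_ineq_of_ge (s : ℝ) (hs : (0.7 : ℝ) ≤ s) :
    0 < s * deriv (deriv theta3) s + deriv theta3 s * theta3 s -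
      s * (deriv theta3 s) ^ 2 := by
  have h0 : 0 < s := by linarith
  have hx : 2.19 ≤ Real.pi * s := by nlinarith [Real.pi_gt_d2]
  rw [theta3_deriv2 h0, theta3_deriv h0, theta3_eq_s7 h0]
  have a := thT_mono 0 h0
  have b := thT_mono 1 h0
  have c := thT_pos 1 h0
  have d := thT_one_le h0 hx
  norm_num at a b
  set x := Real.pi * s with hxd
  have k : 0 < x * (1 - 2 * thT 1 s) - (1 + 2 * thT 0 s) := by nlinarith
  have k2 : 0 < 2 * Real.pi * (thT 1 s * (x * (1 - 2 * thT 1 s) - (1 + 2 * thT 0 s))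
      + x * (thT 2 s - thT 1 s)) := by
    have : 0 ≤ x * (thT 2 s - thT 1 s) := mul_nonneg (by linarith) (by linarith)
    have := mul_pos c k
    have := Real.pi_pos
    positivity
  rw [hxd] at k2
  linarith
end

section
/- For every s > 0, the identity s · θ₃'(s)/θ₃(s) + (1/s) · θ₃'(1/s)/θ₃(1/s) = −1/2 holds. -/
theorem theta3_aux_term (s : ℝ) (k : ℤ) :
    ((Real.exp (-Real.pi * (k : ℝ) ^ 2 * s) : ℝ) : ℂ) = jacobiTheta₂_term k 0 (Complex.I * s) := by
  unfold jacobiTheta₂_term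
  push_cast
  congr 1
  linear_combination (-(Real.pi : ℂ) * k ^ 2 * s) * Complex.I_sq

theorem theta3_aux_eq (s : ℝ) : theta3 s = (jacobiTheta (Complex.I * s)).re := by
  rw [jacobiTheta_eq_jacobiTheta₂, jacobiTheta₂]
  simp_rw [← theta3_aux_term]
  rw [← Complex.ofReal_tsum, Complex.ofReal_re, theta3]

theorem theta3_aux_pos (s : ℝ) (hs : 0 < s) : 0 < theta3 s := by
  have h : Summable fun k : ℤ => Real.exp (-Real.pi * (k : ℝ) ^ 2 * s) := by
    rw [← Complex.summable_ofReal]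
    simp_rw [theta3_aux_term]
    rw [summable_jacobiTheta₂_term_iff]
    simpa using hs
  exact h.tsum_pos (fun k => (Real.exp_pos _).le) 0 (Real.exp_pos _)

theorem theta3_aux_diff (s : ℝ) (hs : 0 < s) : DifferentiableAt ℝ theta3 s := by
  have h1 : DifferentiableAt ℂ (fun z : ℂ => jacobiTheta (Complex.I * z)) (s : ℂ) := by
    have h2 : DifferentiableAt ℂ jacobiTheta (Complex.I * (s : ℂ)) :=
      differentiableAt_jacobiTheta (by simpa using hs)
    exact h2.comp (s : ℂ) (by fun_prop)
  have h3 := h1.hasDerivAt.real_of_complex.differentiableAt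
  have : theta3 = fun x : ℝ => (jacobiTheta (Complex.I * (x : ℂ))).re := funext theta3_aux_eq
  rw [this]
  exact h3

theorem theta3_aux_fe (s : ℝ) (hs : 0 < s) : theta3 s⁻¹ = s ^ (1 / 2 : ℝ) * theta3 s := by
  have h := Real.tsum_exp_neg_mul_int_sq hs
  have h1 : theta3 s = ∑' n : ℤ, Real.exp (-Real.pi * s * (n : ℝ) ^ 2) := by
    unfold theta3; congr 1; ext k; congr 1; ring
  have h2 : theta3 s⁻¹ = ∑' n : ℤ, Real.exp (-Real.pi / s * (n : ℝ) ^ 2) := by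
    unfold theta3; congr 1; ext k; congr 1; ring
  rw [← h1, ← h2] at h
  have := Real.rpow_pos_of_pos hs (1 / 2)
  rw [h]; field_simp

theorem theta3_log_deriv_identity (s : ℝ) (hs : 0 < s) :
    s * deriv theta3 s / theta3 s +
      (1 / s) * deriv theta3 (1 / s) / theta3 (1 / s) = -(1 / 2) := by
  rw [one_div s]
  have hi : 0 < s⁻¹ := inv_pos.mpr hs
  have p := theta3_aux_pos s hs
  have d1 := (theta3_aux_diff s hs).hasDerivAt
  have d2 := (theta3_aux_diff s⁻¹ hi).hasDerivAt.comp s (hasDerivAt_inv hs.ne')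
  have d3 := (Real.hasDerivAt_rpow_const (x := s) (p := 1 / 2) (Or.inl hs.ne')).mul d1
  have d4 := d3.congr_of_eventuallyEq (f₁ := theta3 ∘ Inv.inv) (by
    filter_upwards [lt_mem_nhds hs] with x hx
    exact theta3_aux_fe x hx)
  have e := d2.unique d4
  have r := Real.rpow_pos_of_pos hs (1 / 2)
  rw [Real.rpow_sub_one hs.ne'] at e
  rw [theta3_aux_fe s hs]
  generalize deriv theta3 s⁻¹ = D at *
  generalize deriv theta3 s = E at *
  generalize s ^ (1 / 2 : ℝ) = R at *
  have hD : D = -s ^ 2 * (1 / 2 * (R / s) * theta3 s + R * E) := by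
    rw [← e]; field_simp
  rw [hD]
  field_simp
  ring
end

section
/- Let f : (0, ∞) → (0, ∞) be differentiable and suppose that s ↦ s · f'(s)/f(s) is strictly increasing on (0, ∞). Then for every fixed r > 0, the function F_r(s) = f(rs) · f(r/s) attains its global minimum at s = 1, and s = 1 is its only critical point; in particular F_r(s) > F_r(1) for all s ≠ 1. Analogously, if s ↦ s · f'(s)/f(s) is strictly decreasing on (0, ∞), then F_r attains its global maximum at s = 1, s = 1 is its only critical point, and F_r(s) < F_r(1) for all s ≠ 1. -/
theorem aux_deriv_s9 (f f' : ℝ → ℝ)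
    (hderiv : ∀ s ∈ Set.Ioi (0 : ℝ), HasDerivAt f (f' s) s)
    (hpos : ∀ s ∈ Set.Ioi (0 : ℝ), 0 < f s)
    (r : ℝ) (hr : 0 < r) (s : ℝ) (hs : 0 < s) :
    HasDerivAt (fun t : ℝ => f (r * t) * f (r / t))
      (f (r * s) * f (r / s) / s *
        ((r * s) * f' (r * s) / f (r * s) - (r / s) * f' (r / s) / f (r / s))) s := by
  have h1 : 0 < r * s := by positivity
  have h2 : 0 < r / s := by positivity
  have p1 := hpos _ h1
  have p2 := hpos _ h2
  have a1 : HasDerivAt (fun t : ℝ => r * t) r s := by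
    simpa using (hasDerivAt_id s).const_mul r
  have a2 : HasDerivAt (fun t : ℝ => r / t) (-(r / s ^ 2)) s := by
    have := (hasDerivAt_inv hs.ne').const_mul r
    simpa [div_eq_mul_inv] using this
  have d1 : HasDerivAt (fun t : ℝ => f (r * t)) (f' (r * s) * r) s :=
    HasDerivAt.comp s (hderiv _ h1) a1
  have d2 : HasDerivAt (fun t : ℝ => f (r / t)) (f' (r / s) * (-(r / s ^ 2))) s :=
    HasDerivAt.comp s (hderiv _ h2) a2
  refine (d1.fun_mul d2).congr_deriv ?_
  generalize f (r * s) = A at *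
  generalize f (r / s) = B at *
  generalize f' (r * s) = C at *
  generalize f' (r / s) = D at *
  field_simp
  ring

theorem aux_mono_s9 (f f' : ℝ → ℝ)
    (hderiv : ∀ s ∈ Set.Ioi (0 : ℝ), HasDerivAt f (f' s) s)
    (hpos : ∀ s ∈ Set.Ioi (0 : ℝ), 0 < f s)
    (r : ℝ) (hr : 0 < r)
    (hm : StrictMonoOn (fun s : ℝ => s * f' s / f s) (Set.Ioi 0)) :
    (∀ s ∈ Set.Ioi (0 : ℝ), s ≠ 1 → f r * f r < f (r * s) * f (r / s)) ∧
      (∀ s ∈ Set.Ioi (0 : ℝ),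
        HasDerivAt (fun t : ℝ => f (r * t) * f (r / t)) 0 s → s = 1) := by
  have hF : ∀ s : ℝ, 0 < s → 0 < f (r * s) * f (r / s) / s := fun s hs =>
    div_pos (mul_pos (hpos _ (mul_pos hr hs)) (hpos _ (div_pos hr hs))) hs
  have key : ∀ s : ℝ, 1 < s → f r * f r < f (r * s) * f (r / s) := by
    intro s hs
    have hmono : StrictMonoOn (fun t : ℝ => f (r * t) * f (r / t)) (Set.Ici 1) := by
      apply strictMonoOn_of_deriv_pos (convex_Ici 1)
      · intro x hx
        have hx0 : 0 < x := lt_of_lt_of_le one_pos hx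
        exact (aux_deriv_s9 f f' hderiv hpos r hr x hx0).continuousAt.continuousWithinAt
      · intro x hx
        rw [interior_Ici] at hx
        have hx1 : 1 < x := hx
        have hx0 : 0 < x := one_pos.trans hx1
        rw [(aux_deriv_s9 f f' hderiv hpos r hr x hx0).deriv]
        apply mul_pos (hF x hx0)
        have hlt : r / x < r * x := by
          rw [div_lt_iff₀ hx0]
          nlinarith [mul_pos hr (sub_pos.2 hx1), mul_pos (mul_pos hr hx0) (sub_pos.2 hx1)]
        exact sub_pos.2 (hm (div_pos hr hx0) (mul_pos hr hx0) hlt)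
    have := hmono (Set.mem_Ici.2 le_rfl) (Set.mem_Ici.2 hs.le) hs
    simpa using this
  refine ⟨?_, ?_⟩
  · intro s hs h1
    have hs0 : 0 < s := hs
    rcases lt_or_gt_of_ne h1 with h | h
    · have := key s⁻¹ ((one_lt_inv₀ hs0).2 h)
      rw [div_inv_eq_mul, ← div_eq_mul_inv, mul_comm (f (r / s))] at this
      exact this
    · exact key s h
  · intro s hs h0
    have hs0 : 0 < s := hs
    have e := h0.unique (aux_deriv_s9 f f' hderiv hpos r hr s hs0)
    have e2 := (mul_eq_zero.1 e.symm).resolve_left (hF s hs0).ne'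
    have e3 := hm.injOn (Set.mem_Ioi.2 (mul_pos hr hs0)) (Set.mem_Ioi.2 (div_pos hr hs0))
      (sub_eq_zero.1 e2)
    rw [eq_div_iff hs0.ne'] at e3
    have : r * ((s - 1) * (s + 1)) = 0 := by linarith
    have h4 := (mul_eq_zero.1 this).resolve_left hr.ne'
    have h5 := (mul_eq_zero.1 h4).resolve_right (by positivity)
    linarith

theorem useful_lemma (f f' : ℝ → ℝ)
    (hderiv : ∀ s ∈ Set.Ioi (0 : ℝ), HasDerivAt f (f' s) s)
    (hpos : ∀ s ∈ Set.Ioi (0 : ℝ), 0 < f s)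
    (r : ℝ) (hr : 0 < r) :
    (StrictMonoOn (fun s : ℝ => s * f' s / f s) (Set.Ioi 0) →
      (∀ s ∈ Set.Ioi (0 : ℝ), s ≠ 1 → f r * f r < f (r * s) * f (r / s)) ∧
      (∀ s ∈ Set.Ioi (0 : ℝ),
        HasDerivAt (fun t : ℝ => f (r * t) * f (r / t)) 0 s → s = 1)) ∧
    (StrictAntiOn (fun s : ℝ => s * f' s / f s) (Set.Ioi 0) →
      (∀ s ∈ Set.Ioi (0 : ℝ), s ≠ 1 → f (r * s) * f (r / s) < f r * f r) ∧
      (∀ s ∈ Set.Ioi (0 : ℝ),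
        HasDerivAt (fun t : ℝ => f (r * t) * f (r / t)) 0 s → s = 1)) := by
  refine ⟨aux_mono_s9 f f' hderiv hpos r hr, fun ha => ?_⟩
  have H := aux_mono_s9 (fun s => (f s)⁻¹) (fun s => -f' s / f s ^ 2)
    (fun s hs => (hderiv s hs).fun_inv (hpos s hs).ne')
    (fun s hs => inv_pos.2 (hpos s hs)) r hr (by
      intro a ha0 b hb0 hab
      have h := ha ha0 hb0 hab
      have pa := hpos a ha0
      have pb := hpos b hb0
      have ea : a * (-f' a / f a ^ 2) / (f a)⁻¹ = -(a * f' a / f a) := by field_simp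
      have eb : b * (-f' b / f b ^ 2) / (f b)⁻¹ = -(b * f' b / f b) := by field_simp
      simp only [ea, eb]
      exact neg_lt_neg h)
  refine ⟨fun s hs h1 => ?_, fun s hs h0 => ?_⟩
  · have h := H.1 s hs h1
    simp only [← mul_inv] at h
    exact (inv_lt_inv₀ (mul_pos (hpos _ hr) (hpos _ hr))
      (mul_pos (hpos _ (mul_pos hr hs)) (hpos _ (div_pos hr hs)))).1 h
  · apply H.2 s hs
    have h := h0.fun_inv
      (mul_pos (hpos _ (mul_pos hr hs)) (hpos _ (div_pos hr hs))).ne'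
    simpa only [mul_inv, neg_zero, zero_div] using h
end
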